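/- arXiv:2209.02195 — 6 statements merged into one kernel-verified Lean document; each statement's English description precedes it below -/
import Mathlib

section
/- Let M = (S, 𝓘) be a matroid on a finite ground set S, let ≻ be a linear order on S, and let A and B be disjoint bases of M. Call a bijection f : A → B an A-exchange bijection if A − a + f(a) ∈ 𝓘 for every a ∈ A, and call a bijection g : A → B a B-exchange bijection if B + a − g(a) ∈ 𝓘 for every a ∈ A. Then A-exchange bijections and B-exchange bijections exist, and max{ |{a ∈ A : f(a) ≻ a}| : f is an A-exchange bijection } ≥ min{ |{a ∈ A : g(a) ≻ a}| : g is a B-exchange bijection }. -/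
open Finset

noncomputable section

/-- A matroid on the finite ground set `α`, given by its independence predicate on finsets. -/
structure FinMatroid (α : Type*) [DecidableEq α] where
  Indep : Finset α → Prop
  exists_indep : ∃ I, Indep I
  indep_subset : ∀ ⦃I J : Finset α⦄, I ⊆ J → Indep J → Indep I
  indep_exchange : ∀ ⦃I J : Finset α⦄, Indep I → Indep J → I.card < J.card →
    ∃ v ∈ J \ I, Indep (insert v I)

/-- A base of a matroid: an inclusionwise maximal independent set. -/
def FinMatroid.IsBase {α : Type*} [DecidableEq α] (M : FinMatroid α) (B : Finset α) : Prop :=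
  M.Indep B ∧ ∀ ⦃X : Finset α⦄, M.Indep X → B ⊆ X → X = B

/-- `f` is an `A`-exchange bijection: a bijection from `A` to `B` with
`A - a + f(a)` independent for every `a ∈ A`. -/
def AExchange {α : Type*} [DecidableEq α] (M : FinMatroid α) (A B : Finset α) (f : α → α) :
    Prop :=
  Set.BijOn f ↑A ↑B ∧ ∀ a ∈ A, M.Indep (insert (f a) (A.erase a))

/-- `g` is a `B`-exchange bijection: a bijection from `A` to `B` with
`B + a - g(a)` independent for every `a ∈ A`. -/
def BExchange {α : Type*} [DecidableEq α] (M : FinMatroid α) (A B : Finset α) (g : α → α) :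
    Prop :=
  Set.BijOn g ↑A ↑B ∧ ∀ a ∈ A, M.Indep (insert a (B.erase (g a)))

/-- The Mathlib matroid with ground set `univ` and the same independent finsets. -/
def FinMatroid.toMatroid {α : Type*} [DecidableEq α] (M : FinMatroid α) : Matroid α :=
  (IndepMatroid.ofFinset Set.univ M.Indep
    (M.exists_indep.elim fun _ hI => M.indep_subset (empty_subset _) hI)
    (fun _ _ hJ hIJ => M.indep_subset hIJ hJ)
    (fun _ _ hI hJ hIJ => by
      obtain ⟨v, hv, h⟩ := M.indep_exchange hI hJ hIJ
      exact ⟨v, (mem_sdiff.1 hv).1, (mem_sdiff.1 hv).2, h⟩)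
    (fun _ _ => Set.subset_univ _)).matroid

lemma FinMatroid.toMatroid_indep {α : Type*} [DecidableEq α] (M : FinMatroid α) (I : Finset α) :
    M.toMatroid.Indep (I : Set α) ↔ M.Indep I := by
  simp only [FinMatroid.toMatroid, IndepMatroid.matroid_Indep, IndepMatroid.ofFinset_indep]

lemma FinMatroid.toMatroid_ground {α : Type*} [DecidableEq α] (M : FinMatroid α) :
    M.toMatroid.E = Set.univ := rfl

lemma FinMatroid.IsBase.toMatroid_isBase {α : Type*} [DecidableEq α] {M : FinMatroid α}
    {B : Finset α} (hB : M.IsBase B) : M.toMatroid.IsBase (B : Set α) := by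
  refine Matroid.Indep.isBase_of_forall_insert ((M.toMatroid_indep B).2 hB.1) fun e he hi => ?_
  rw [← coe_insert, M.toMatroid_indep] at hi
  have := hB.2 hi (subset_insert e B)
  exact he.2 (by rw [← this]; simp)

/-- An element lies in every closed set that contains all elements of a base it can replace. -/
lemma FinMatroid.IsBase.mem_closure_of_exchange {α : Type*} [DecidableEq α] {M : FinMatroid α}
    {A : Finset α} (hA : M.IsBase A) {e : α} (he : e ∉ A) {W : Set α}
    (h : ∀ x ∈ A, M.Indep (insert e (A.erase x)) → x ∈ M.toMatroid.closure W) :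
    e ∈ M.toMatroid.closure W := by
  have hA' := hA.toMatroid_isBase
  have heA : e ∈ M.toMatroid.closure (A : Set α) := by
    rw [hA'.closure_eq, M.toMatroid_ground]; trivial
  have he' : e ∉ (A : Set α) := he
  have hC := hA'.indep.fundCircuit_isCircuit heA he'
  have hmem := hC.mem_closure_sdiff_singleton_of_mem (M.toMatroid.mem_fundCircuit e A)
  refine Matroid.closure_subset_closure_of_subset_closure (fun x hx => ?_) hmem
  have hxA : x ∈ A := by
    have := M.toMatroid.fundCircuit_subset_insert e A hx.1
    exact (Set.mem_insert_iff.1 this).resolve_left hx.2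
  have hi := (hA'.indep.mem_fundCircuit_iff heA he').1 hx.1
  refine h x hxA ((M.toMatroid_indep _).1 ?_)
  convert hi using 1
  ext y
  have : e ≠ x := fun h => he (h ▸ hxA)
  simp only [coe_insert, coe_erase, Set.mem_insert_iff, Set.mem_sdiff, Set.mem_singleton_iff,
    mem_coe]
  grind

lemma FinMatroid.IsBase.card_eq {α : Type*} [DecidableEq α] {M : FinMatroid α}
    {A B : Finset α} (hA : M.IsBase A) (hB : M.IsBase B) : A.card = B.card := by
  simpa [Set.ncard_coe_finset] using
    hA.toMatroid_isBase.ncard_eq_ncard_of_isBase hB.toMatroid_isBase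

/-- Two parts `X ⊆ A`, `Y ⊆ B` of disjoint bases have at most `|A|` elements together as soon as
some height function increases along all exchange pairs between them: `(A - a) + b` independent
forces `b` below `a`, and `(B - b) + a` independent forces `a` below `b`. -/
lemma FinMatroid.IsBase.card_add_card_le_of_height {α β : Type*} [DecidableEq α] [Fintype α]
    [LinearOrder β] {M : FinMatroid α} {A B X Y : Finset α}
    (hA : M.IsBase A) (hB : M.IsBase B) (hAB : Disjoint A B) (hX : X ⊆ A) (hY : Y ⊆ B)
    (φ : α → β)
    (hφA : ∀ a ∈ X, ∀ b ∈ Y, M.Indep (insert b (A.erase a)) → φ b < φ a)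
    (hφB : ∀ a ∈ X, ∀ b ∈ Y, M.Indep (insert a (B.erase b)) → φ a < φ b) :
    X.card + Y.card ≤ A.card := by
  set W : Finset α := (A \ X) ∪ (B \ Y)
  have hWcl : ∀ x ∈ W, x ∈ M.toMatroid.closure W := fun x hx =>
    M.toMatroid.subset_closure (W : Set α) (Set.subset_univ _) hx
  have key : ∀ x, x ∈ X ∪ Y → x ∈ M.toMatroid.closure W := by
    intro x
    induction x using (Finite.wellFounded_of_trans_of_irrefl
      (fun x y : α => φ y < φ x)).induction with
    | _ x ih =>
    intro hx
    rcases mem_union.1 hx with hx | hx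
    · refine hB.mem_closure_of_exchange (disjoint_left.1 hAB (hX hx)) fun b hb hi => ?_
      by_cases hbY : b ∈ Y
      · exact ih b (hφB x hx b hbY hi) (mem_union_right _ hbY)
      · exact hWcl b (mem_union_right _ (mem_sdiff.2 ⟨hb, hbY⟩))
    · refine hA.mem_closure_of_exchange (disjoint_right.1 hAB (hY hx)) fun a ha hi => ?_
      by_cases haX : a ∈ X
      · exact ih a (hφA a haX x hx hi) (mem_union_left _ haX)
      · exact hWcl a (mem_union_left _ (mem_sdiff.2 ⟨ha, haX⟩))
  have hAW : (A : Set α) ⊆ M.toMatroid.closure W := by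
    intro a ha
    by_cases haX : a ∈ X
    · exact key a (mem_union_left _ haX)
    · exact hWcl a (mem_union_left _ (mem_sdiff.2 ⟨ha, haX⟩))
  have hspan : M.toMatroid.Spanning (W : Set α) := by
    refine (Matroid.spanning_iff_ground_subset_closure (Set.subset_univ _)).2 ?_
    rw [← hA.toMatroid_isBase.closure_eq]
    exact Matroid.closure_subset_closure_of_subset_closure hAW
  obtain ⟨D, hD, hDW⟩ := hspan.exists_isBase_subset
  have h1 : A.card = D.ncard := by
    rw [← hA.toMatroid_isBase.ncard_eq_ncard_of_isBase hD, Set.ncard_coe_finset]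
  have h2 : D.ncard ≤ W.card := by
    rw [← Set.ncard_coe_finset]; exact Set.ncard_le_ncard hDW W.finite_toSet
  have h3 : W.card ≤ (A \ X).card + (B \ Y).card := card_union_le _ _
  rw [card_sdiff_of_subset hX, card_sdiff_of_subset hY] at h3
  have := card_le_card hX
  have := card_le_card hY
  have := hA.card_eq hB
  omega

/-- Hall's theorem for perfect matchings between two finsets of the same size. -/
lemma exists_bijOn_of_card_add_card_le {α : Type*} {A B : Finset α} (hcard : A.card = B.card)
    (R : α → α → Prop)
    (h : ∀ X ⊆ A, ∀ Y ⊆ B, (∀ a ∈ X, ∀ b ∈ Y, ¬ R a b) → X.card + Y.card ≤ A.card) :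
    ∃ f : α → α, Set.BijOn f ↑A ↑B ∧ ∀ a ∈ A, R a (f a) := by
  classical
  obtain ⟨f, hf, hfR⟩ := (Finset.all_card_le_biUnion_card_iff_exists_injective
    (fun a : A => B.filter (R a))).1 fun s => by
      have := h (s.map (Function.Embedding.subtype _)) (fun x hx => by
        obtain ⟨y, -, rfl⟩ := mem_map.1 hx; exact y.2)
        (B \ s.biUnion fun a => B.filter (R a)) sdiff_subset
        (by
          intro a ha b hb hR
          obtain ⟨y, hy, rfl⟩ := mem_map.1 ha
          rw [mem_sdiff] at hb
          exact hb.2 (mem_biUnion.2 ⟨y, hy, mem_filter.2 ⟨hb.1, hR⟩⟩))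
      have hsub : (s.biUnion fun a : A => B.filter (R a)) ⊆ B :=
        biUnion_subset.2 fun _ _ => filter_subset _ _
      rw [card_map, card_sdiff_of_subset hsub] at this
      have := card_le_card hsub
      omega
  have hmaps : ∀ a ∈ A, (fun a => if ha : a ∈ A then f ⟨a, ha⟩ else a) a ∈ B := fun a ha => by
    simpa [ha] using (mem_filter.1 (hfR ⟨a, ha⟩)).1
  have hinj : Set.InjOn (fun a => if ha : a ∈ A then f ⟨a, ha⟩ else a) ↑A := by
    intro a ha b hb hab
    rw [mem_coe] at ha hb
    simp only [ha, hb, dif_pos] at hab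
    exact congrArg Subtype.val (hf hab)
  refine ⟨fun a => if ha : a ∈ A then f ⟨a, ha⟩ else a, ⟨hmaps, hinj, ?_⟩, fun a ha => ?_⟩
  · exact Finset.surjOn_of_injOn_of_card_le _ hmaps hinj hcard.ge
  · simpa [ha] using (mem_filter.1 (hfR ⟨a, ha⟩)).2

/-- Egerváry's theorem: a maximum weight perfect matching, with an optimal dual solution. -/
lemma exists_bijOn_and_potential {α : Type*} {A B : Finset α} (G : α → α → Prop)
    (w : α → α → ℤ) (hG : ∃ f : α → α, Set.BijOn f ↑A ↑B ∧ ∀ a ∈ A, G a (f a)) :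
    ∃ (f : α → α) (y z : α → ℤ), Set.BijOn f ↑A ↑B ∧ (∀ a ∈ A, G a (f a)) ∧
      (∀ a ∈ A, ∀ b ∈ B, G a b → w a b ≤ y a + z b) ∧
      ∑ a ∈ A, y a + ∑ b ∈ B, z b = ∑ a ∈ A, w a (f a) := by
  classical
  obtain ⟨f₀, hf₀, hf₀G⟩ := hG
  have sum_comp : ∀ {f : α → α}, Set.BijOn f ↑A ↑B → ∀ z : α → ℤ,
      ∑ a ∈ A, z (f a) = ∑ b ∈ B, z b := fun hf z =>
    sum_bij (fun a _ => _) (fun a ha => hf.mapsTo ha) (fun a ha b hb h => hf.injOn ha hb h)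
      (fun b hb => (hf.surjOn hb).imp fun a ha => ⟨ha.1, ha.2⟩) (fun _ _ => rfl)
  have hcard : A.card = B.card :=
    card_bij (fun a _ => f₀ a) (fun a ha => hf₀.mapsTo ha) (fun a ha b hb h => hf₀.injOn ha hb h)
      (fun b hb => (hf₀.surjOn hb).imp fun a ha => ⟨ha.1, ha.2⟩)
  obtain ⟨m, ⟨y, z, hyz, rfl⟩, hmin⟩ := Int.exists_least_of_bdd
    (P := fun m => ∃ y z : α → ℤ, (∀ a ∈ A, ∀ b ∈ B, G a b → w a b ≤ y a + z b) ∧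
      ∑ a ∈ A, y a + ∑ b ∈ B, z b = m)
    ⟨∑ a ∈ A, w a (f₀ a), by
      rintro _ ⟨y, z, hyz, rfl⟩
      rw [← sum_comp hf₀ z, ← sum_add_distrib]
      exact sum_le_sum fun a ha => hyz a ha _ (hf₀.mapsTo ha) (hf₀G a ha)⟩
    ⟨_, fun a => ∑ b ∈ B, |w a b|, fun _ => 0, fun a _ b hb _ => by
      rw [add_zero]
      exact (le_abs_self _).trans
        (single_le_sum (f := fun b => |w a b|) (fun b _ => abs_nonneg _) hb), rfl⟩
  obtain ⟨f, hf, hfG⟩ := exists_bijOn_of_card_add_card_le hcard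
    (fun a b => G a b ∧ y a + z b = w a b) fun X hX Y hY hXY => by
      have := hmin _ ⟨fun a => y a - if a ∈ X then 1 else 0,
        fun b => z b + if b ∈ B \ Y then 1 else 0, fun a ha b hb hab => by
          have h1 := hyz a ha b hb hab
          by_cases haX : a ∈ X <;> by_cases hbY : b ∈ Y
          · have := fun h => hXY a haX b hbY ⟨hab, h⟩
            simp only [haX, hbY, mem_sdiff]
            grind
          all_goals
            simp only [haX, hbY, hb, mem_sdiff]
            grind, rfl⟩
      rw [sum_sub_distrib, sum_add_distrib, sum_ite_mem, sum_ite_mem,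
        inter_eq_right.2 hX, inter_eq_right.2 sdiff_subset] at this
      simp only [sum_const, nsmul_eq_mul, mul_one] at this
      have h2 := card_le_card hY
      rw [card_sdiff_of_subset hY] at this
      omega
  refine ⟨f, y, z, hf, fun a ha => (hfG a ha).1, hyz, ?_⟩
  rw [← sum_comp hf z, ← sum_add_distrib]
  exact sum_congr rfl fun a ha => (hfG a ha).2

/-- Potentials dominating the ascents of all `A`-exchange pairs have at least the total of
potentials dominated by the ascents of all `B`-exchange pairs. -/
lemma FinMatroid.IsBase.sum_potential_le {α : Type*} [DecidableEq α] [Fintype α] [LinearOrder α]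
    {M : FinMatroid α} {A B : Finset α}
    (hA : M.IsBase A) (hB : M.IsBase B) (hAB : Disjoint A B) (y z y' z' : α → ℤ)
    (hyz : ∀ a ∈ A, ∀ b ∈ B, M.Indep (insert b (A.erase a)) →
      (if a < b then 1 else 0) ≤ y a + z b)
    (hyz' : ∀ a ∈ A, ∀ b ∈ B, M.Indep (insert a (B.erase b)) →
      y' a + z' b ≤ if a < b then 1 else 0) :
    ∑ a ∈ A, y' a + ∑ b ∈ B, z' b ≤ ∑ a ∈ A, y a + ∑ b ∈ B, z b := by
  obtain ⟨π, hπ, hle⟩ := exists_bijOn_of_card_add_card_le (hA.card_eq hB)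
    (fun a b => z' b - z b ≤ y a - y' a) fun X hX Y hY hXY => by
      refine hA.card_add_card_le_of_height hB hAB hX hY
        (fun e => if e ∈ A then toLex (y e, e) else toLex (-z e, e)) ?_ ?_
      all_goals
        intro a ha b hb hi
        have haA := hX ha
        have hbB := hY hb
        have hbA := disjoint_right.1 hAB hbB
        have hne : a ≠ b := fun h => hbA (h ▸ haA)
        have hlt := not_le.1 (hXY a ha b hb)
        simp only [haA, hbA, if_true, if_false, Prod.Lex.toLex_lt_toLex]
      · have := hyz a haA b hbB hi
        split_ifs at this with hab
        · left; omega
        · rcases (show -z b ≤ y a by omega).lt_or_eq with h | h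
          · exact Or.inl h
          · exact Or.inr ⟨h, lt_of_le_of_ne (not_lt.1 hab) hne.symm⟩
      · have := hyz' a haA b hbB hi
        split_ifs at this with hab
        · rcases (show y a ≤ -z b by omega).lt_or_eq with h | h
          · exact Or.inl h
          · exact Or.inr ⟨h, hab⟩
        · left; omega
  have sum_comp : ∑ a ∈ A, (z' (π a) - z (π a)) = ∑ b ∈ B, (z' b - z b) :=
    sum_bij (fun a _ => π a) (fun a ha => hπ.mapsTo ha) (fun a ha b hb h => hπ.injOn ha hb h)
      (fun b hb => (hπ.surjOn hb).imp fun a ha => ⟨ha.1, ha.2⟩) (fun _ _ => rfl)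
  have := sum_le_sum hle
  rw [sum_comp, sum_sub_distrib, sum_sub_distrib] at this
  linarith

lemma FinMatroid.IsBase.exists_aExchange {α : Type*} [DecidableEq α] [Fintype α]
    {M : FinMatroid α} {A B : Finset α}
    (hA : M.IsBase A) (hB : M.IsBase B) (hAB : Disjoint A B) : ∃ f : α → α, AExchange M A B f :=
  exists_bijOn_of_card_add_card_le (hA.card_eq hB)
    (fun a b => M.Indep (insert b (A.erase a))) fun X hX Y hY hXY =>
      hA.card_add_card_le_of_height hB hAB hX hY (fun e => if e ∈ A then 0 else 1)
        (fun a ha b hb hi => (hXY a ha b hb hi).elim)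
        (fun a ha b hb _ => by simp [hX ha, disjoint_right.1 hAB (hY hb)])

lemma FinMatroid.IsBase.exists_bExchange {α : Type*} [DecidableEq α] [Fintype α]
    {M : FinMatroid α} {A B : Finset α}
    (hA : M.IsBase A) (hB : M.IsBase B) (hAB : Disjoint A B) : ∃ g : α → α, BExchange M A B g :=
  exists_bijOn_of_card_add_card_le (hA.card_eq hB)
    (fun a b => M.Indep (insert a (B.erase b))) fun X hX Y hY hXY =>
      hA.card_add_card_le_of_height hB hAB hX hY (fun e => if e ∈ A then 1 else 0)
        (fun a ha b hb _ => by simp [hX ha, disjoint_right.1 hAB (hY hb)])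
        (fun a ha b hb hi => (hXY a ha b hb hi).elim)

/-- `A`-exchange and `B`-exchange bijections between two disjoint bases `A`, `B`
exist, and the maximum over `A`-exchange bijections `f` of `#{a ∈ A : f a ≻ a}` is at least
the minimum over `B`-exchange bijections `g` of `#{a ∈ A : g a ≻ a}`.  (Here `u ≻ v` is `u > v`
in the given linear order.) -/
theorem stmt_0 {α : Type*} [DecidableEq α] [Fintype α] [LinearOrder α]
    (M : FinMatroid α) (A B : Finset α)
    (hA : M.IsBase A) (hB : M.IsBase B) (hAB : Disjoint A B) :
    (∃ f : α → α, AExchange M A B f) ∧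
    (∃ g : α → α, BExchange M A B g) ∧
    sInf {n : ℤ | ∃ g : α → α, BExchange M A B g ∧
        n = ((A.filter fun a => a < g a).card : ℤ)} ≤
      sSup {n : ℤ | ∃ f : α → α, AExchange M A B f ∧
        n = ((A.filter fun a => a < f a).card : ℤ)} := by
  have hf := hA.exists_aExchange hB hAB
  have hg := hA.exists_bExchange hB hAB
  refine ⟨hf, hg, ?_⟩
  obtain ⟨f, y, z, hfb, hfG, hyz, hsum⟩ := exists_bijOn_and_potential
    (fun a b => M.Indep (insert b (A.erase a))) (fun a b => if a < b then 1 else 0) hf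
  obtain ⟨g, y', z', hgb, hgG, hyz', hsum'⟩ := exists_bijOn_and_potential
    (fun a b => M.Indep (insert a (B.erase b))) (fun a b => -if a < b then 1 else 0) hg
  have hle := hA.sum_potential_le hB hAB y z (fun a => -y' a) (fun b => -z' b) hyz
    fun a ha b hb hi => by have := hyz' a ha b hb hi; linarith
  simp only [sum_neg_distrib] at hle hsum'
  have hgf : ((A.filter fun a => a < g a).card : ℤ) ≤ ((A.filter fun a => a < f a).card : ℤ) := by
    rw [card_filter, card_filter]
    push_cast
    linarith
  refine le_trans (csInf_le ?_ ?_) (hgf.trans (le_csSup ?_ ?_))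
  · refine ⟨0, ?_⟩
    rintro _ ⟨_, _, rfl⟩
    positivity
  · exact ⟨g, ⟨hgb, hgG⟩, rfl⟩
  · refine ⟨A.card, ?_⟩
    rintro _ ⟨_, _, rfl⟩
    exact_mod_cast card_filter_le _ _
  · exact ⟨f, ⟨hfb, hfG⟩, rfl⟩

end
end

section
/- Let M = (S, 𝓘) be a matroid on a finite ground set S given as a direct sum M = M_1 ⊕ … ⊕ M_k of matroids M_j = (S_j, 𝓘_j) on pairwise disjoint sets S_j partitioning S, and let ≻ be a linear order on S. Then for any two independent sets I, J ∈ 𝓘, vote(I,J) + vote(J,I) ≤ 0. -/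
open Finset
open scoped Classical

noncomputable section

/-- `N` is a pairing between `I \ J` and `J \ I`: a set of pairwise disjoint pairs `(u, v)`
with `u ∈ I \ J` and `v ∈ J \ I`. -/
def IsPairing {α : Type*} [DecidableEq α] (I J : Finset α) (N : Finset (α × α)) : Prop :=
  (∀ p ∈ N, p.1 ∈ I \ J ∧ p.2 ∈ J \ I) ∧
  (∀ p ∈ N, ∀ q ∈ N, p.1 = q.1 → p = q) ∧
  (∀ p ∈ N, ∀ q ∈ N, p.2 = q.2 → p = q)

/-- `N` is a weakly feasible pairing for `(I, J)`:
(1) `I - u + v` is independent for every `(u, v) ∈ N`, and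
(2) every `v ∈ J \ I` with `I + v` dependent is covered by `N`. -/
def WeaklyFeasible {α : Type*} [DecidableEq α] (M : FinMatroid α) (I J : Finset α)
    (N : Finset (α × α)) : Prop :=
  IsPairing I J N ∧
  (∀ p ∈ N, M.Indep (insert p.2 (I.erase p.1))) ∧
  (∀ v ∈ J \ I, ¬ M.Indep (insert v I) → ∃ p ∈ N, p.2 = v)

/-- `N` is a feasible pairing for `(I, J)` with respect to the direct-sum partition
`part : α → ι`: in addition to weak feasibility,
(3) every `u ∈ I \ J` with `J + u` dependent is covered by `N`,
(4) both entries of each pair lie in the same part, and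
(5) for every part `j`, the number of pairs inside part `j` is
`min (|S_j ∩ (I \ J)|, |S_j ∩ (J \ I)|)`. -/
def Feasible {α ι : Type*} [DecidableEq α] (M : FinMatroid α) (part : α → ι)
    (I J : Finset α) (N : Finset (α × α)) : Prop :=
  WeaklyFeasible M I J N ∧
  (∀ u ∈ I \ J, ¬ M.Indep (insert u J) → ∃ p ∈ N, p.1 = u) ∧
  (∀ p ∈ N, part p.1 = part p.2) ∧
  (∀ j : ι, (N.filter fun p => part p.1 = j).card =
    min (((I \ J).filter fun a => part a = j).card) (((J \ I).filter fun a => part a = j).card))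

/-- `vote(I, J, N) = |{(u,v) ∈ N : u ≻ v}| - |{(u,v) ∈ N : v ≻ u}| + |I| - |J|`,
where `gt a b` means `a ≻ b`. -/
def voteN {α : Type*} (gt : α → α → Prop) (I J : Finset α) (N : Finset (α × α)) : ℤ :=
  ((N.filter fun p => gt p.1 p.2).card : ℤ) - ((N.filter fun p => gt p.2 p.1).card : ℤ)
    + (I.card : ℤ) - (J.card : ℤ)

/-- `vote•(I, J)`: the minimum of `vote(I, J, N)` over weakly feasible pairings `N` for
`(I, J)`. -/
def voteB {α : Type*} [DecidableEq α] (M : FinMatroid α) (gt : α → α → Prop)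
    (I J : Finset α) : ℤ :=
  sInf {z : ℤ | ∃ N : Finset (α × α), WeaklyFeasible M I J N ∧ z = voteN gt I J N}

/-- `vote(I, J)`: the minimum of `vote(I, J, N)` over feasible pairings `N` for `(I, J)`. -/
def voteF {α ι : Type*} [DecidableEq α] (M : FinMatroid α) (gt : α → α → Prop)
    (part : α → ι) (I J : Finset α) : ℤ :=
  sInf {z : ℤ | ∃ N : Finset (α × α), Feasible M part I J N ∧ z = voteN gt I J N}

/-- Hall's theorem for a relation between two finsets. -/
theorem exists_injOn_of_hall {α : Type*} [DecidableEq α] (U V : Finset α) (r : α → α → Prop)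
    (h : ∀ A ⊆ U, ∃ B ⊆ V, A.card ≤ B.card ∧ ∀ v ∈ B, ∃ u ∈ A, r u v) :
    ∃ f : α → α, (∀ u ∈ U, f u ∈ V ∧ r u (f u)) ∧ Set.InjOn f U := by
  have hall := (Finset.all_card_le_biUnion_card_iff_exists_injective
    (fun u : {u // u ∈ U} => V.filter fun v => r u v)).1 (by
      intro s
      obtain ⟨B, hBV, hle, hB⟩ := h (s.map (Function.Embedding.subtype _)) (by
        intro a ha
        obtain ⟨b, _, rfl⟩ := Finset.mem_map.1 ha
        exact b.2)
      rw [Finset.card_map] at hle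
      refine hle.trans (Finset.card_le_card ?_)
      intro v hv
      obtain ⟨u, hu, hr⟩ := hB v hv
      obtain ⟨b, hb, rfl⟩ := Finset.mem_map.1 hu
      exact Finset.mem_biUnion.2 ⟨b, hb, Finset.mem_filter.2 ⟨hBV hv, hr⟩⟩)
  obtain ⟨f, hinj, hf⟩ := hall
  refine ⟨fun u => if hu : u ∈ U then f ⟨u, hu⟩ else u, ?_, ?_⟩
  · intro u hu
    simpa [hu] using hf ⟨u, hu⟩
  · intro a ha b hb hab
    have ha' : a ∈ U := ha
    have hb' : b ∈ U := hb
    simp only [ha', hb', dif_pos] at hab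
    exact congrArg Subtype.val (hinj hab)

theorem sum_comp_eq_of_injOn {α : Type*} [DecidableEq α] {U V : Finset α} {f : α → α}
    (hcard : U.card = V.card) (hf : ∀ u ∈ U, f u ∈ V) (hinj : Set.InjOn f U) (d : α → ℤ) :
    ∑ u ∈ U, d (f u) = ∑ v ∈ V, d v := by
  have himg : U.image f = V := by
    apply Finset.eq_of_subset_of_card_le
    · exact Finset.image_subset_iff.2 hf
    · rw [Finset.card_image_of_injOn hinj, hcard]
  rw [← himg, Finset.sum_image hinj]

/-- If above every integer level `U` strictly dominates `V`, then the sums differ by at least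
the cardinality. -/
theorem card_le_sum_sub_sum {α : Type*} [DecidableEq α] {U V : Finset α}
    (hcard : U.card = V.card) (d : α → ℤ)
    (h : ∀ c : ℤ, (V.filter fun v => c ≤ d v).card + (U.filter fun u => d u ≤ c).card ≤ U.card) :
    (U.card : ℤ) ≤ ∑ u ∈ U, d u - ∑ v ∈ V, d v := by
  obtain ⟨f, hf, hinj⟩ := exists_injOn_of_hall V U (fun v u => d v + 1 ≤ d u) (by
    intro A hA
    rcases A.eq_empty_or_nonempty with rfl | hne
    · exact ⟨∅, by simp⟩
    obtain ⟨a, ha, hmin⟩ := Finset.exists_min_image A d hne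
    have h1 := h (d a)
    have h2 : A.card ≤ (V.filter fun v => d a ≤ d v).card :=
      Finset.card_le_card fun v hv => Finset.mem_filter.2 ⟨hA hv, hmin v hv⟩
    have h3 := Finset.card_filter_add_card_filter_not (s := U) (fun u => d u ≤ d a)
    refine ⟨U.filter fun u => ¬ d u ≤ d a, Finset.filter_subset _ _, by omega, fun u hu => ?_⟩
    have := (Finset.mem_filter.1 hu).2
    exact ⟨a, ha, by omega⟩)
  have hs := sum_comp_eq_of_injOn hcard.symm (fun v hv => (hf v hv).1) hinj d
  have hle : ∑ v ∈ V, (d v + 1) ≤ ∑ v ∈ V, d (f v) :=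
    Finset.sum_le_sum fun v hv => (hf v hv).2
  rw [Finset.sum_add_distrib, Finset.sum_const, nsmul_eq_mul, mul_one] at hle
  rw [hcard]
  linarith

/-- Step of the Hungarian method: a feasible integral potential either admits a perfect matching
of tight edges, or can be replaced by a feasible potential of smaller total. -/
theorem exists_tight_matching_or_exists_lt {α : Type*} [DecidableEq α] {U V : Finset α}
    (hdisj : Disjoint U V) (G : α → α → Prop) (w : α → α → ℤ) (s : α → ℤ)
    (hs : ∀ u ∈ U, ∀ v ∈ V, G u v → w u v ≤ s u - s v) :
    (∃ f : α → α, (∀ u ∈ U, f u ∈ V ∧ G u (f u) ∧ w u (f u) = s u - s (f u)) ∧ Set.InjOn f U) ∨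
    ∃ s' : α → ℤ, (∀ u ∈ U, ∀ v ∈ V, G u v → w u v ≤ s' u - s' v) ∧
      ∑ u ∈ U, s' u - ∑ v ∈ V, s' v < ∑ u ∈ U, s u - ∑ v ∈ V, s v := by
  by_cases h : ∀ A ⊆ U,
      A.card ≤ (V.filter fun v => ∃ u ∈ A, G u v ∧ w u v = s u - s v).card
  · exact Or.inl (exists_injOn_of_hall U V (fun u v => G u v ∧ w u v = s u - s v)
      fun A hA => ⟨_, Finset.filter_subset _ _, h A hA, fun v hv => (Finset.mem_filter.1 hv).2⟩)
  right
  push Not at h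
  obtain ⟨A, hA, hlt⟩ := h
  set B := V.filter fun v => ∃ u ∈ A, G u v ∧ w u v = s u - s v
  have hBV : B ⊆ V := Finset.filter_subset _ _
  have hUB : ∀ u ∈ U, u ∉ B := fun u hu hb => Finset.disjoint_left.1 hdisj hu (hBV hb)
  have hVA : ∀ v ∈ V, v ∉ A := fun v hv ha => Finset.disjoint_left.1 hdisj (hA ha) hv
  refine ⟨fun a => s a - ((if a ∈ A then 1 else 0) + if a ∈ B then 1 else 0), ?_, ?_⟩
  · intro u hu v hv hG
    have h1 := hs u hu v hv hG
    have h2 := hUB u hu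
    have h3 := hVA v hv
    by_cases hua : u ∈ A <;> by_cases hvb : v ∈ B <;> simp only [h2, h3, hua, hvb, if_true, if_false]
    · omega
    · have : w u v ≠ s u - s v := fun he =>
        hvb (Finset.mem_filter.2 ⟨hv, u, hua, hG, he⟩)
      omega
    · omega
    · omega
  · have e1 : ∑ u ∈ U, (s u - ((if u ∈ A then 1 else 0) + if u ∈ B then 1 else 0)) =
        ∑ u ∈ U, s u - A.card := by
      have e : ∑ u ∈ U, (((if u ∈ A then 1 else 0) + if u ∈ B then 1 else 0) : ℤ) =
          ∑ u ∈ U, if u ∈ A then 1 else 0 :=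
        Finset.sum_congr rfl fun u hu => by simp [hUB u hu]
      rw [Finset.sum_sub_distrib, e]
      simp [Finset.inter_eq_right.2 hA]
    have e2 : ∑ v ∈ V, (s v - ((if v ∈ A then 1 else 0) + if v ∈ B then 1 else 0)) =
        ∑ v ∈ V, s v - B.card := by
      have e : ∑ v ∈ V, (((if v ∈ A then 1 else 0) + if v ∈ B then 1 else 0) : ℤ) =
          ∑ v ∈ V, if v ∈ B then 1 else 0 :=
        Finset.sum_congr rfl fun v hv => by simp [hVA v hv]
      rw [Finset.sum_sub_distrib, e]
      simp [Finset.inter_eq_right.2 hBV]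
    rw [e1, e2]
    omega

namespace FinMatroid

variable {α : Type*} [DecidableEq α]

/-- An independent set can be enlarged from a larger one up to the size of the latter. -/
theorem exists_extension (M : FinMatroid α) {I J : Finset α} (hI : M.Indep I) (hJ : M.Indep J)
    (h : I.card ≤ J.card) :
    ∃ K, I ⊆ K ∧ K ⊆ I ∪ J ∧ M.Indep K ∧ K.card = J.card := by
  obtain ⟨n, hn⟩ : ∃ n, J.card - I.card = n := ⟨_, rfl⟩
  induction n generalizing I with
  | zero => exact ⟨I, subset_rfl, Finset.subset_union_left, hI, by omega⟩
  | succ n ih =>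
    obtain ⟨v, hv, hi⟩ := M.indep_exchange hI hJ (by omega)
    rw [Finset.mem_sdiff] at hv
    have hc := Finset.card_insert_of_notMem hv.2
    obtain ⟨K, h1, h2, h3, h4⟩ := ih hi (by omega) (by omega)
    refine ⟨K, (Finset.subset_insert _ _).trans h1, fun a ha => ?_, h3, h4⟩
    have := h2 ha
    simp only [Finset.mem_union, Finset.mem_insert] at this ⊢
    rcases this with (rfl | h) | h
    · exact Or.inr hv.1
    · exact Or.inl h
    · exact Or.inr h

/-- The truncation of a matroid to rank at most `r`. -/
def truncate (M : FinMatroid α) (r : ℕ) : FinMatroid α where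
  Indep X := M.Indep X ∧ X.card ≤ r
  exists_indep := by
    obtain ⟨I, hI⟩ := M.exists_indep
    exact ⟨∅, M.indep_subset (Finset.empty_subset _) hI, by simp⟩
  indep_subset := fun I J h hJ =>
    ⟨M.indep_subset h hJ.1, (Finset.card_le_card h).trans hJ.2⟩
  indep_exchange := fun I J hI hJ h => by
    obtain ⟨v, hv, hi⟩ := M.indep_exchange hI.1 hJ.1 h
    refine ⟨v, hv, hi, ?_⟩
    have := Finset.card_insert_le v I
    have := hJ.2
    omega

/-- An element of a basis lying on a circuit can be exchanged for an element of that circuit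
outside the basis. -/
theorem exists_exchange_of_circuit (M : FinMatroid α) {I C : Finset α} (hI : M.Indep I)
    (hmax : ∀ X, M.Indep X → X.card ≤ I.card) (hC : ¬ M.Indep C)
    {y : α} (hyI : y ∈ I) (hCy : M.Indep (C.erase y)) :
    ∃ x ∈ C, x ∉ I ∧ M.Indep (insert x (I.erase y)) := by
  obtain ⟨B, h1, h2, h3, h4⟩ := M.exists_extension hCy hI (hmax _ hCy)
  have hyB : y ∉ B := fun hyB => hC <| M.indep_subset (fun a ha => by
    by_cases hay : a = y
    · exact hay ▸ hyB
    · exact h1 (Finset.mem_erase.2 ⟨hay, ha⟩)) h3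
  obtain ⟨x, hx, hi⟩ := M.indep_exchange (M.indep_subset (Finset.erase_subset y I) hI) h3
    (by rw [h4]; exact Finset.card_erase_lt_of_mem hyI)
  rw [Finset.mem_sdiff, Finset.mem_erase, not_and] at hx
  have hxy : x ≠ y := fun h => hyB (h ▸ hx.1)
  have hxI := hx.2 hxy
  refine ⟨x, ?_, hxI, hi⟩
  rcases Finset.mem_union.1 (h2 hx.1) with h | h
  · exact Finset.mem_of_mem_erase h
  · exact absurd h hxI

/-- `s` makes `I` the optimal set among its single exchanges with elements of `J`, when elements
are compared by `s` and then by the linear order. -/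
def ExchangeOptimal [LinearOrder α] (M : FinMatroid α) (I J : Finset α) (s : α → ℤ) : Prop :=
  ∀ u ∈ I \ J, ∀ v ∈ J \ I, M.Indep (insert v (I.erase u)) →
    toLex (s v, v) < toLex (s u, u)

theorem exchangeOptimal_iff [LinearOrder α] (M : FinMatroid α) (I J : Finset α) (s : α → ℤ) :
    M.ExchangeOptimal I J s ↔ ∀ u ∈ I \ J, ∀ v ∈ J \ I, M.Indep (insert v (I.erase u)) →
      (if u < v then (1 : ℤ) else 0) ≤ s u - s v := by
  refine forall₂_congr fun u hu => forall₂_congr fun v hv => imp_congr_right fun _ => ?_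
  have hne : u ≠ v := fun h =>
    (Finset.mem_sdiff.1 hv).2 (h ▸ (Finset.mem_sdiff.1 hu).1)
  rw [Prod.Lex.toLex_lt_toLex]
  rcases lt_or_gt_of_ne hne with h | h
  · simp only [h, if_true, not_lt_of_gt h, and_false, or_false]
    omega
  · simp only [h, not_lt_of_gt h, if_false, and_true]
    omega

/-- The minimal element of a circuit of `I ∪ J` outside `I ∩ J` does not lie in an optimal `I`. -/
theorem notMem_of_minimal_of_exchangeOptimal [LinearOrder α] (M : FinMatroid α)
    {I J C : Finset α} {s : α → ℤ} (hI : M.Indep I)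
    (hmax : ∀ X, M.Indep X → X.card ≤ I.card) (hs : M.ExchangeOptimal I J s)
    (hCIJ : C ⊆ I ∪ J) (hC : ¬ M.Indep C) (hCmin : ∀ y ∈ C, M.Indep (C.erase y))
    {y : α} (hyC : y ∈ C) (hyJ : y ∈ I → y ∉ J)
    (hy : ∀ x ∈ C, ¬ (x ∈ I ∧ x ∈ J) → toLex (s y, y) ≤ toLex (s x, x)) : y ∉ I := by
  intro hyI
  obtain ⟨x, hxC, hxI, hi⟩ := M.exists_exchange_of_circuit hI hmax hC hyI (hCmin y hyC)
  have hxJ : x ∈ J := (Finset.mem_union.1 (hCIJ hxC)).resolve_left hxI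
  exact absurd (hs y (Finset.mem_sdiff.2 ⟨hyI, hyJ hyI⟩) x (Finset.mem_sdiff.2 ⟨hxJ, hxI⟩) hi)
    (not_lt_of_ge (hy x hxC fun h => hxI h.1))

/-- Two bases that are optimal for the potentials `s` and `t` are separated by `s - t`. -/
theorem card_le_sum_of_exchangeOptimal [LinearOrder α] (M : FinMatroid α) {I J : Finset α}
    {s t : α → ℤ} (hI : M.Indep I) (hJ : M.Indep J) (hcard : I.card = J.card)
    (hmax : ∀ X, M.Indep X → X.card ≤ I.card)
    (hs : M.ExchangeOptimal I J s) (ht : M.ExchangeOptimal J I t) :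
    ((I \ J).card : ℤ) ≤ ∑ u ∈ I \ J, (s u - t u) - ∑ v ∈ J \ I, (s v - t v) := by
  refine card_le_sum_sub_sum (U := I \ J) (V := J \ I) (Finset.card_sdiff_comm hcard)
    (fun a => s a - t a) fun c => ?_
  set X := (J \ I).filter fun v => c ≤ s v - t v
  set Y := (I \ J).filter fun u => s u - t u ≤ c
  have hXJ : ∀ x ∈ X, x ∈ J ∧ x ∉ I := fun x hx =>
    Finset.mem_sdiff.1 (Finset.mem_filter.1 hx).1
  have hYI : ∀ y ∈ Y, y ∈ I ∧ y ∉ J := fun y hy =>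
    Finset.mem_sdiff.1 (Finset.mem_filter.1 hy).1
  have hXY : Disjoint X Y := Finset.disjoint_left.2 fun a ha hb => (hXJ a ha).2 (hYI a hb).1
  have hK : Disjoint (X ∪ Y) (I ∩ J) := Finset.disjoint_left.2 fun a ha hb => by
    rw [Finset.mem_inter] at hb
    rcases Finset.mem_union.1 ha with h | h
    · exact (hXJ a h).2 hb.1
    · exact (hYI a h).2 hb.2
  suffices hind : M.Indep ((X ∪ Y) ∪ (I ∩ J)) by
    have h1 := hmax _ hind
    rw [Finset.card_union_of_disjoint hK, Finset.card_union_of_disjoint hXY] at h1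
    have h2 := Finset.card_sdiff_add_card_inter I J
    omega
  by_contra hdep
  obtain ⟨C, hCsub, hCmem⟩ := exists_minimal_le_of_wellFoundedLT
    (fun C => ¬ M.Indep C) _ hdep
  have hC : ¬ M.Indep C := hCmem.prop
  have hCmin : ∀ y ∈ C, M.Indep (C.erase y) := fun y hy => by
    by_contra hd
    exact hCmem.not_prop_of_lt (Finset.erase_ssubset hy) hd
  have hCIJ : C ⊆ I ∪ J := fun a ha => by
    have h := hCsub ha
    simp only [Finset.mem_union, Finset.mem_inter] at h ⊢
    rcases h with (h | h) | h
    · exact Or.inr (hXJ a h).1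
    · exact Or.inl (hYI a h).1
    · exact Or.inl h.1
  have hmem : ∀ a ∈ C, ¬ (a ∈ I ∧ a ∈ J) → a ∈ X ∨ a ∈ Y := fun a ha h => by
    have h' := hCsub ha
    simp only [Finset.mem_union, Finset.mem_inter] at h'
    exact h'.resolve_right h
  set D := C.filter fun a => ¬ (a ∈ I ∧ a ∈ J)
  have hDne : D.Nonempty := by
    rw [Finset.nonempty_iff_ne_empty]
    intro he
    refine hC (M.indep_subset (fun a ha => ?_) hI)
    by_contra haI
    have : a ∈ D := Finset.mem_filter.2 ⟨ha, fun h => haI h.1⟩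
    rw [he] at this
    exact absurd this (Finset.notMem_empty a)
  obtain ⟨x, hx, hxmin⟩ := Finset.exists_min_image D (fun a => toLex (s a, a)) hDne
  obtain ⟨y, hy, hymin⟩ := Finset.exists_min_image D (fun a => toLex (t a, a)) hDne
  have hxD := Finset.mem_filter.1 hx
  have hyD := Finset.mem_filter.1 hy
  have hxI : x ∉ I := M.notMem_of_minimal_of_exchangeOptimal hI hmax hs hCIJ hC hCmin hxD.1
    (fun h h' => hxD.2 ⟨h, h'⟩) fun a ha h => hxmin a (Finset.mem_filter.2 ⟨ha, h⟩)
  have hyJ : y ∉ J := M.notMem_of_minimal_of_exchangeOptimal hJ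
    (fun Z hZ => hcard ▸ hmax Z hZ) ht (by rwa [Finset.union_comm]) hC hCmin hyD.1
    (fun h h' => hyD.2 ⟨h', h⟩)
    fun a ha h => hymin a (Finset.mem_filter.2 ⟨ha, fun h' => h ⟨h'.2, h'.1⟩⟩)
  have hxX : x ∈ X := (hmem x hxD.1 hxD.2).resolve_right fun h => hxI (hYI x h).1
  have hyY : y ∈ Y := (hmem y hyD.1 hyD.2).resolve_left fun h => hyJ (hXJ y h).1
  have hne : x ≠ y := fun h => hxI (h ▸ (hYI y hyY).1)
  have h1 := hxmin y hy
  have h2 := hymin x hx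
  simp only [Prod.Lex.toLex_le_toLex] at h1 h2
  have h3 := (Finset.mem_filter.1 hxX).2
  have h4 := (Finset.mem_filter.1 hyY).2
  rcases h1 with h1 | ⟨h1, h1'⟩ <;> rcases h2 with h2 | ⟨h2, h2'⟩
  · omega
  · omega
  · omega
  · exact hne (le_antisymm h1' h2')

/-- Independent sets of equal size admit perfect exchange matchings in both directions in which
together at least half of the pairs improve. -/
theorem exists_exchange_matchings [LinearOrder α] (M : FinMatroid α) {I J : Finset α}
    (hI : M.Indep I) (hJ : M.Indep J) (hcard : I.card = J.card) :
    ∃ f g : α → α,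
      (∀ u ∈ I \ J, f u ∈ J \ I ∧ M.Indep (insert (f u) (I.erase u))) ∧
      Set.InjOn f (I \ J : Finset α) ∧
      (∀ v ∈ J \ I, g v ∈ I \ J ∧ M.Indep (insert (g v) (J.erase v))) ∧
      Set.InjOn g (J \ I : Finset α) ∧
      (I \ J).card ≤ ((I \ J).filter fun u => u < f u).card +
        ((J \ I).filter fun v => v < g v).card := by
  have hc : (I \ J).card = (J \ I).card := Finset.card_sdiff_comm hcard
  have hdisj : Disjoint (I \ J) (J \ I) := disjoint_sdiff_sdiff
  have hopt : ∀ {A B : Finset α} {s : α → ℤ}, M.ExchangeOptimal A B s →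
      (M.truncate I.card).ExchangeOptimal A B s :=
    fun hs u hu v hv h => hs u hu v hv h.1
  have bound : ∀ s t : α → ℤ, M.ExchangeOptimal I J s → M.ExchangeOptimal J I t →
      ((I \ J).card : ℤ) ≤ (∑ u ∈ I \ J, s u - ∑ v ∈ J \ I, s v) +
        (∑ v ∈ J \ I, t v - ∑ u ∈ I \ J, t u) := by
    intro s t hs ht
    have := (M.truncate I.card).card_le_sum_of_exchangeOptimal (I := I) (J := J)
      ⟨hI, le_rfl⟩ ⟨hJ, hcard.ge⟩ hcard (fun X hX => hX.2) (hopt hs) (hopt ht)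
    simp only [Finset.sum_sub_distrib] at this
    linarith
  have key : ∀ n : ℕ, ∀ s t : α → ℤ, M.ExchangeOptimal I J s → M.ExchangeOptimal J I t →
      (∑ u ∈ I \ J, s u - ∑ v ∈ J \ I, s v) + (∑ v ∈ J \ I, t v - ∑ u ∈ I \ J, t u) < n →
      ∃ s t : α → ℤ, M.ExchangeOptimal I J s ∧ M.ExchangeOptimal J I t ∧
        (∃ f : α → α, (∀ u ∈ I \ J, f u ∈ J \ I ∧ M.Indep (insert (f u) (I.erase u)) ∧
          (if u < f u then (1 : ℤ) else 0) = s u - s (f u)) ∧ Set.InjOn f (I \ J : Finset α)) ∧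
        (∃ g : α → α, (∀ v ∈ J \ I, g v ∈ I \ J ∧ M.Indep (insert (g v) (J.erase v)) ∧
          (if v < g v then (1 : ℤ) else 0) = t v - t (g v)) ∧
          Set.InjOn g (J \ I : Finset α)) := by
    intro n
    induction n with
    | zero =>
      intro s t hs ht hn
      have := bound s t hs ht
      omega
    | succ n ih =>
      intro s t hs ht hn
      rcases exists_tight_matching_or_exists_lt hdisj
        (fun u v => M.Indep (insert v (I.erase u))) _ s ((M.exchangeOptimal_iff I J s).1 hs) with
        hf | ⟨s', hs', hlt⟩
      · rcases exists_tight_matching_or_exists_lt hdisj.symm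
          (fun u v => M.Indep (insert v (J.erase u))) _ t ((M.exchangeOptimal_iff J I t).1 ht) with
          hg | ⟨t', ht', hlt⟩
        · exact ⟨s, t, hs, ht, hf, hg⟩
        · exact ih s t' hs ((M.exchangeOptimal_iff J I t').2 ht') (by push_cast at hn; linarith)
      · exact ih s' t ((M.exchangeOptimal_iff I J s').2 hs') ht (by push_cast at hn; linarith)
  have exchangeOptimal_indicator : ∀ A B : Finset α, M.ExchangeOptimal A B fun a => if a ∈ A then 1 else 0 := by
    intro A B
    rw [exchangeOptimal_iff]
    intro u hu v hv _
    simp only [(Finset.mem_sdiff.1 hu).1, (Finset.mem_sdiff.1 hv).2, if_true, if_false]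
    split_ifs <;> norm_num
  obtain ⟨s, t, hs, ht, ⟨f, hf, hfi⟩, ⟨g, hg, hgi⟩⟩ :=
    key _ _ _ (exchangeOptimal_indicator I J) (exchangeOptimal_indicator J I)
      (Int.lt_add_one_of_le (Int.self_le_toNat _))
  refine ⟨f, g, fun u hu => ⟨(hf u hu).1, (hf u hu).2.1⟩, hfi,
    fun v hv => ⟨(hg v hv).1, (hg v hv).2.1⟩, hgi, ?_⟩
  have h1 := bound s t hs ht
  have h2 := sum_comp_eq_of_injOn hc (fun u hu => (hf u hu).1) hfi s
  have h3 := sum_comp_eq_of_injOn hc.symm (fun v hv => (hg v hv).1) hgi t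
  rw [← h2, ← h3, ← Finset.sum_sub_distrib, ← Finset.sum_sub_distrib,
    ← Finset.sum_congr rfl (fun u hu => (hf u hu).2.2),
    ← Finset.sum_congr rfl (fun v hv => (hg v hv).2.2), Finset.sum_boole, Finset.sum_boole] at h1
  exact_mod_cast h1

end FinMatroid

section Pairings

variable {α : Type*} [DecidableEq α]

theorem isPairing_image {I J : Finset α} {f : α → α} (hf : ∀ u ∈ I \ J, f u ∈ J \ I)
    (hinj : Set.InjOn f (I \ J : Finset α)) :
    IsPairing I J ((I \ J).image fun u => (u, f u)) := by
  refine ⟨?_, ?_, ?_⟩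
  · intro p hp
    obtain ⟨u, hu, rfl⟩ := Finset.mem_image.1 hp
    exact ⟨hu, hf u hu⟩
  · intro p hp q hq h
    obtain ⟨u, hu, rfl⟩ := Finset.mem_image.1 hp
    obtain ⟨v, hv, rfl⟩ := Finset.mem_image.1 hq
    obtain rfl : u = v := h
    rfl
  · intro p hp q hq h
    obtain ⟨u, hu, rfl⟩ := Finset.mem_image.1 hp
    obtain ⟨v, hv, rfl⟩ := Finset.mem_image.1 hq
    obtain rfl : u = v := hinj hu hv h
    rfl

theorem card_image_graph (U : Finset α) (f : α → α) :
    (U.image fun u => (u, f u)).card = U.card :=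
  Finset.card_image_of_injective _ fun _ _ h => congrArg Prod.fst h

theorem card_filter_image_graph (U : Finset α) (f : α → α) (r : α → α → Prop)
    [DecidableRel r] :
    ((U.image fun u => (u, f u)).filter fun p => r p.1 p.2).card =
      (U.filter fun u => r u (f u)).card := by
  rw [Finset.filter_image]
  exact card_image_graph _ f

theorem IsPairing.exists_fst_eq {I J : Finset α} {N : Finset (α × α)} (h : IsPairing I J N)
    (hcard : N.card = (I \ J).card) {u : α} (hu : u ∈ I \ J) : ∃ p ∈ N, p.1 = u := by
  have himg : N.image Prod.fst = I \ J := by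
    apply Finset.eq_of_subset_of_card_le
    · exact Finset.image_subset_iff.2 fun p hp => (h.1 p hp).1
    · rw [Finset.card_image_of_injOn fun p hp q hq => h.2.1 p hp q hq, hcard]
  exact Finset.mem_image.1 (himg ▸ hu)

theorem IsPairing.exists_snd_eq {I J : Finset α} {N : Finset (α × α)} (h : IsPairing I J N)
    (hcard : N.card = (J \ I).card) {v : α} (hv : v ∈ J \ I) : ∃ p ∈ N, p.2 = v := by
  have himg : N.image Prod.snd = J \ I := by
    apply Finset.eq_of_subset_of_card_le
    · exact Finset.image_subset_iff.2 fun p hp => (h.1 p hp).2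
    · rw [Finset.card_image_of_injOn fun p hp q hq => h.2.2 p hp q hq, hcard]
  exact Finset.mem_image.1 (himg ▸ hv)

theorem IsPairing.mono {I J I' J' : Finset α} {N : Finset (α × α)} (h : IsPairing I J N)
    (hI : I \ J ⊆ I' \ J') (hJ : J \ I ⊆ J' \ I') : IsPairing I' J' N :=
  ⟨fun p hp => ⟨hI (h.1 p hp).1, hJ (h.1 p hp).2⟩, h.2⟩

/-- Feasibility of a pairing when the partition has a single part. -/
def SinglePartFeasible (M : FinMatroid α) (I J : Finset α) (N : Finset (α × α)) : Prop :=
  WeaklyFeasible M I J N ∧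
  (∀ u ∈ I \ J, ¬ M.Indep (insert u J) → ∃ p ∈ N, p.1 = u) ∧
  N.card = min (I \ J).card (J \ I).card

theorem exists_singlePartFeasible_of_card_le [LinearOrder α] (M : FinMatroid α) {I J : Finset α}
    (hI : M.Indep I) (hJ : M.Indep J) (hle : I.card ≤ J.card) :
    ∃ N N' : Finset (α × α), SinglePartFeasible M I J N ∧ SinglePartFeasible M J I N' ∧
      N.card ≤ (N.filter fun p => p.1 < p.2).card + (N'.filter fun p => p.1 < p.2).card := by
  obtain ⟨K, hIK, hKIJ, hK, hKJ⟩ := M.exists_extension hI hJ hle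
  have hKsub : K \ J = I \ J := by
    ext a
    have h1 := @hIK a
    have h2 := @hKIJ a
    simp only [Finset.mem_sdiff, Finset.mem_union] at h1 h2 ⊢
    tauto
  have hJsub : J \ K ⊆ J \ I := Finset.sdiff_subset_sdiff subset_rfl hIK
  have hc : (K \ J).card = (J \ K).card := Finset.card_sdiff_comm hKJ
  have hmin : (I \ J).card ≤ (J \ I).card := by
    rw [← hKsub, hc]
    exact Finset.card_le_card hJsub
  obtain ⟨f, g, hf, hfi, hg, hgi, hcount⟩ := M.exists_exchange_matchings hK hJ hKJ
  have hN := isPairing_image (fun u hu => (hf u hu).1) hfi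
  have hN' := isPairing_image (fun v hv => (hg v hv).1) hgi
  have hNc := card_image_graph (K \ J) f
  have hNc' := card_image_graph (J \ K) g
  have hdep : ∀ v ∈ J \ I, ¬ M.Indep (insert v I) → v ∈ J \ K := fun v hv hd =>
    Finset.mem_sdiff.2 ⟨(Finset.mem_sdiff.1 hv).1, fun hvK =>
      hd (M.indep_subset (Finset.insert_subset hvK hIK) hK)⟩
  refine ⟨_, _, ⟨⟨hN.mono hKsub.le hJsub, ?_, ?_⟩, ?_, ?_⟩,
    ⟨⟨hN'.mono hJsub hKsub.le, ?_, ?_⟩, ?_, ?_⟩, ?_⟩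
  · intro p hp
    obtain ⟨u, hu, rfl⟩ := Finset.mem_image.1 hp
    exact M.indep_subset (Finset.insert_subset_insert _ (Finset.erase_subset_erase _ hIK))
      (hf u hu).2
  · exact fun v hv hd => hN.exists_snd_eq (hNc.trans hc) (hdep v hv hd)
  · exact fun u hu _ => hN.exists_fst_eq hNc (hKsub ▸ hu)
  · rw [hNc, hKsub, min_eq_left hmin]
  · intro p hp
    obtain ⟨v, hv, rfl⟩ := Finset.mem_image.1 hp
    exact (hg v hv).2
  · exact fun u hu _ => hN'.exists_snd_eq (hNc'.trans hc.symm) (hKsub ▸ hu)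
  · exact fun v hv hd => hN'.exists_fst_eq hNc' (hdep v hv hd)
  · rw [hNc', ← hc, hKsub, min_eq_right hmin]
  · rw [hNc]
    rwa [card_filter_image_graph (K \ J) f (· < ·), card_filter_image_graph (J \ K) g (· < ·)]

theorem exists_singlePartFeasible [LinearOrder α] (M : FinMatroid α) {I J : Finset α}
    (hI : M.Indep I) (hJ : M.Indep J) :
    ∃ N N' : Finset (α × α), SinglePartFeasible M I J N ∧ SinglePartFeasible M J I N' ∧
      N.card ≤ (N.filter fun p => p.1 < p.2).card + (N'.filter fun p => p.1 < p.2).card := by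
  rcases le_total I.card J.card with h | h
  · exact exists_singlePartFeasible_of_card_le M hI hJ h
  · obtain ⟨N, N', hN, hN', hc⟩ := exists_singlePartFeasible_of_card_le M hJ hI h
    refine ⟨N', N, hN', hN, ?_⟩
    rw [hN'.2.2, min_comm, ← hN.2.2, add_comm]
    exact hc

/-- The union of a family of pairings, the `j`-th of which lives in part `j`. -/
def gluePairings {ι : Type*} [Fintype α] (part : α → ι) (N : ι → Finset (α × α)) :
    Finset (α × α) :=
  Finset.univ.filter fun p => p ∈ N (part p.1)

theorem mem_gluePairings {ι : Type*} [Fintype α] {part : α → ι} {N : ι → Finset (α × α)}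
    {p : α × α} : p ∈ gluePairings part N ↔ p ∈ N (part p.1) := by
  simp [gluePairings]

theorem filter_gluePairings {ι : Type*} [Fintype α] {part : α → ι} {N : ι → Finset (α × α)}
    (hN : ∀ j, ∀ p ∈ N j, part p.1 = j) (j : ι) :
    ((gluePairings part N).filter fun p => part p.1 = j) = N j := by
  ext p
  rw [Finset.mem_filter, mem_gluePairings]
  constructor
  · rintro ⟨h, rfl⟩
    exact h
  · intro h
    have := hN j p h
    exact ⟨this ▸ h, this⟩

theorem card_filter_gluePairings {ι : Type*} [Fintype α] {part : α → ι}
    {N : ι → Finset (α × α)} (hN : ∀ j, ∀ p ∈ N j, part p.1 = j) (r : α × α → Prop)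
    [DecidablePred r] :
    ((gluePairings part N).filter r).card =
      ∑ j ∈ Finset.univ.image part, ((N j).filter r).card := by
  rw [Finset.card_eq_sum_card_fiberwise (f := fun p => part p.1) (t := Finset.univ.image part)
    fun p _ => by simp]
  refine Finset.sum_congr rfl fun j _ => ?_
  rw [← filter_gluePairings hN j, Finset.filter_comm]

theorem SinglePartFeasible.part_eq {ι : Type*} {M : FinMatroid α} {part : α → ι}
    {I J : Finset α} {j : ι} {N : Finset (α × α)}
    (h : SinglePartFeasible M (I.filter fun a => part a = j) (J.filter fun a => part a = j) N)
    {p : α × α} (hp : p ∈ N) : part p.1 = j ∧ part p.2 = j := by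
  have h1 := h.1.1.1 p hp
  exact ⟨(Finset.mem_filter.1 (Finset.mem_sdiff.1 h1.1).1).2,
    (Finset.mem_filter.1 (Finset.mem_sdiff.1 h1.2).1).2⟩

theorem filter_sdiff_filter {ι : Type*} (part : α → ι) (I J : Finset α) (j : ι) :
    (I.filter fun a => part a = j) \ (J.filter fun a => part a = j) =
      (I \ J).filter fun a => part a = j := by
  ext a
  simp only [Finset.mem_sdiff, Finset.mem_filter]
  tauto

/-- In a direct sum, independence of a set that agrees with `I` outside one part can be checked
in that part. -/
theorem indep_of_filter_part {ι : Type*} {M : FinMatroid α} {part : α → ι}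
    (hdsum : ∀ X : Finset α, M.Indep X ↔ ∀ j : ι, M.Indep (X.filter fun a => part a = j))
    {I X : Finset α} (hI : M.Indep I) (j : ι) (hX : ∀ a ∈ X, part a ≠ j → a ∈ I)
    (hj : M.Indep (X.filter fun a => part a = j)) : M.Indep X := by
  rw [hdsum]
  intro k
  by_cases hk : k = j
  · exact hk ▸ hj
  · refine M.indep_subset (fun a ha => ?_) hI
    rw [Finset.mem_filter] at ha
    exact hX a ha.1 (ha.2 ▸ hk)

theorem indep_insert_of_filter {ι : Type*} {M : FinMatroid α} {part : α → ι}
    (hdsum : ∀ X : Finset α, M.Indep X ↔ ∀ j : ι, M.Indep (X.filter fun a => part a = j))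
    {I : Finset α} (hI : M.Indep I) {v : α}
    (hv : M.Indep (insert v (I.filter fun a => part a = part v))) : M.Indep (insert v I) := by
  refine indep_of_filter_part hdsum hI (part v) (fun a ha hne => ?_) ?_
  · rcases Finset.mem_insert.1 ha with rfl | h
    · exact absurd rfl hne
    · exact h
  · rwa [Finset.filter_insert, if_pos rfl]

theorem feasible_gluePairings {ι : Type*} [Fintype α] {M : FinMatroid α} {part : α → ι}
    (hdsum : ∀ X : Finset α, M.Indep X ↔ ∀ j : ι, M.Indep (X.filter fun a => part a = j))
    {I J : Finset α} (hI : M.Indep I) (hJ : M.Indep J) {N : ι → Finset (α × α)}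
    (hN : ∀ j, SinglePartFeasible M (I.filter fun a => part a = j)
      (J.filter fun a => part a = j) (N j)) :
    Feasible M part I J (gluePairings part N) := by
  have hpart : ∀ p ∈ gluePairings part N, part p.1 = part p.2 := fun p hp =>
    ((hN _).part_eq (mem_gluePairings.1 hp)).2.symm
  have hmem : ∀ {j p}, p ∈ N j → p ∈ gluePairings part N := fun {j p} hp => by
    rw [mem_gluePairings, ((hN j).part_eq hp).1]
    exact hp
  refine ⟨⟨⟨?_, ?_, ?_⟩, ?_, ?_⟩, ?_, hpart, ?_⟩
  · intro p hp
    have h := (hN _).1.1.1 p (mem_gluePairings.1 hp)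
    rw [filter_sdiff_filter, filter_sdiff_filter] at h
    exact ⟨(Finset.mem_filter.1 h.1).1, (Finset.mem_filter.1 h.2).1⟩
  · intro p hp q hq h
    rw [mem_gluePairings] at hp hq
    exact (hN _).1.1.2.1 p hp q (h ▸ hq) h
  · intro p hp q hq h
    have h' : part q.1 = part p.1 := by rw [hpart q hq, hpart p hp, h]
    rw [mem_gluePairings] at hp hq
    exact (hN _).1.1.2.2 p hp q (h' ▸ hq) h
  · intro p hp
    have h2 := hpart p hp
    have h := (hN _).1.2.1 p (mem_gluePairings.1 hp)
    refine indep_of_filter_part hdsum hI (part p.1) (fun a ha hne => ?_) ?_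
    · rcases Finset.mem_insert.1 ha with rfl | h
      · exact absurd h2.symm hne
      · exact Finset.mem_of_mem_erase h
    · rwa [Finset.filter_insert, if_pos h2.symm, Finset.filter_erase]
  · intro v hv hd
    obtain ⟨p, hp, rfl⟩ := (hN (part v)).1.2.2 v
      (by rw [filter_sdiff_filter]; exact Finset.mem_filter.2 ⟨hv, rfl⟩)
      fun h => hd (indep_insert_of_filter hdsum hI h)
    exact ⟨p, hmem hp, rfl⟩
  · intro u hu hd
    obtain ⟨p, hp, rfl⟩ := (hN (part u)).2.1 u
      (by rw [filter_sdiff_filter]; exact Finset.mem_filter.2 ⟨hu, rfl⟩)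
      fun h => hd (indep_insert_of_filter hdsum hJ h)
    exact ⟨p, hmem hp, rfl⟩
  · intro j
    rw [filter_gluePairings fun j p hp => ((hN j).part_eq hp).1, (hN j).2.2,
      filter_sdiff_filter, filter_sdiff_filter]

theorem voteF_le_voteN {ι : Type*} [Fintype α] {M : FinMatroid α} {gt : α → α → Prop}
    {part : α → ι} {I J : Finset α} {N : Finset (α × α)} (hN : Feasible M part I J N) :
    voteF M gt part I J ≤ voteN gt I J N := by
  refine csInf_le (Set.Finite.bddBelow ?_) ⟨N, hN, rfl⟩
  refine (Set.finite_range fun N : Finset (α × α) => voteN gt I J N).subset ?_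
  rintro z ⟨N, _, rfl⟩
  exact ⟨N, rfl⟩

theorem voteN_eq_of_isPairing [LinearOrder α] {I J : Finset α} {N : Finset (α × α)}
    (hN : IsPairing I J N) :
    voteN (fun a b => b < a) I J N =
      N.card - 2 * (N.filter fun p => p.1 < p.2).card + I.card - J.card := by
  have h1 := Finset.card_filter_add_card_filter_not (s := N) (fun p : α × α => p.1 < p.2)
  have h2 : (N.filter fun p => ¬ p.1 < p.2) = N.filter fun p => p.2 < p.1 := by
    refine Finset.filter_congr fun p hp => ?_
    have hne : p.1 ≠ p.2 := fun h => (Finset.mem_sdiff.1 (hN.1 p hp).2).2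
      (h ▸ (Finset.mem_sdiff.1 (hN.1 p hp).1).1)
    rw [not_lt]
    exact ⟨fun h => lt_of_le_of_ne h hne.symm, le_of_lt⟩
  rw [h2] at h1
  have h3 : voteN (fun a b => b < a) I J N = ((N.filter fun p => p.2 < p.1).card : ℤ) -
      ((N.filter fun p => p.1 < p.2).card : ℤ) + I.card - J.card := by
    unfold voteN
    congr!
  rw [h3]
  omega

end Pairings

/-- if `M` is the direct sum along the partition `part` (i.e. a set is
independent iff its intersection with each part is), then for any two independent sets
`I`, `J` we have `vote(I,J) + vote(J,I) ≤ 0`.  (`u ≻ v` is `u > v` in the linear order.) -/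
theorem stmt_1 {α ι : Type*} [DecidableEq α] [Fintype α] [LinearOrder α]
    (M : FinMatroid α) (part : α → ι)
    (hdsum : ∀ X : Finset α, M.Indep X ↔ ∀ j : ι, M.Indep (X.filter fun a => part a = j))
    (I J : Finset α) (hI : M.Indep I) (hJ : M.Indep J) :
    voteF M (fun a b => b < a) part I J + voteF M (fun a b => b < a) part J I ≤ 0 := by
  choose N N' hN hN' hc using fun j =>
    exists_singlePartFeasible M ((hdsum I).1 hI j) ((hdsum J).1 hJ j)
  have hF := feasible_gluePairings hdsum hI hJ hN
  have hF' := feasible_gluePairings hdsum hJ hI hN'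
  have h1 := voteF_le_voteN (gt := fun a b => b < a) hF
  have h2 := voteF_le_voteN (gt := fun a b => b < a) hF'
  rw [voteN_eq_of_isPairing hF.1.1] at h1
  rw [voteN_eq_of_isPairing hF'.1.1] at h2
  have hp : ∀ j, ∀ p ∈ N j, part p.1 = j := fun j p hp => ((hN j).part_eq hp).1
  have hp' : ∀ j, ∀ p ∈ N' j, part p.1 = j := fun j p hp => ((hN' j).part_eq hp).1
  have hcard := card_filter_gluePairings hp fun _ => True
  have hcard' := card_filter_gluePairings hp' fun _ => True
  simp only [Finset.filter_true] at hcard hcard'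
  have heq : (gluePairings part N').card = (gluePairings part N).card := by
    rw [hcard, hcard']
    refine Finset.sum_congr rfl fun j _ => ?_
    rw [(hN j).2.2, (hN' j).2.2, min_comm]
  have hle : (gluePairings part N).card ≤
      ((gluePairings part N).filter fun p => p.1 < p.2).card +
        ((gluePairings part N').filter fun p => p.1 < p.2).card := by
    have hsum := Finset.sum_le_sum fun j (_ : j ∈ Finset.univ.image part) => hc j
    rw [Finset.sum_add_distrib, ← hcard] at hsum
    rwa [card_filter_gluePairings hp, card_filter_gluePairings hp']
  omega

end
end

section
/- Let (S, 𝓘, ≻) be an ordered matroid on a finite ground set. Then for any two independent sets I, J ∈ 𝓘, vote•(I,J) + vote•(J,I) ≤ 0. -/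
open Finset
open scoped Classical

noncomputable section

/-- An independent set `T` extends inside `T ∪ K` to an independent set at least as large as the
independent set `K`. -/
theorem FinMatroid.exists_indep_between {α : Type*} [DecidableEq α] (M : FinMatroid α)
    {T K : Finset α} (hT : M.Indep T) (hK : M.Indep K) :
    ∃ Z, M.Indep Z ∧ T ⊆ Z ∧ Z ⊆ T ∪ K ∧ K.card ≤ Z.card := by
  induction hn : K.card - T.card generalizing T with
  | zero => exact ⟨T, hT, Subset.rfl, subset_union_left, by omega⟩
  | succ n ih =>
    obtain ⟨v, hv, hvT⟩ := M.indep_exchange hT hK (by omega)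
    rw [mem_sdiff] at hv
    have hcard := card_insert_of_notMem hv.2
    obtain ⟨Z, hZ, hTZ, hZK, hle⟩ := ih hvT (by omega)
    refine ⟨Z, hZ, (subset_insert v T).trans hTZ, hZK.trans ?_, hle⟩
    intro z hz
    simp only [mem_union, mem_insert] at hz ⊢
    rcases hz with (rfl | hz) | hz
    · exact Or.inr hv.1
    · exact Or.inl hz
    · exact Or.inr hz

theorem FinMatroid.card_le_of_spanned {α : Type*} [DecidableEq α] (M : FinMatroid α)
    {T K : Finset α} (hT : M.Indep T) (hK : M.Indep K)
    (h : ∀ t ∈ T, t ∉ K → ¬ M.Indep (insert t K)) : T.card ≤ K.card := by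
  by_contra! hlt
  obtain ⟨v, hv, hvK⟩ := M.indep_exchange hK hT hlt
  rw [mem_sdiff] at hv
  exact h v hv.1 hv.2 hvK

/-- If `K` spans the independent set `T` and `K + x` is independent, then so is `T + x`. -/
theorem FinMatroid.indep_insert_of_spanned {α : Type*} [DecidableEq α] (M : FinMatroid α)
    {T K : Finset α} {x : α} (hxK : x ∉ K) (hK : M.Indep (insert x K)) (hT : M.Indep T)
    (h : ∀ t ∈ T, t ∉ K → ¬ M.Indep (insert t K)) : M.Indep (insert x T) := by
  obtain ⟨Z, hZ, hTZ, hZK, hle⟩ := M.exists_indep_between hT hK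
  by_cases hx : x ∈ Z
  · exact M.indep_subset (insert_subset hx hTZ) hZ
  · exfalso
    have hZle : Z.card ≤ K.card := by
      refine M.card_le_of_spanned hZ (M.indep_subset (subset_insert x K) hK) fun t ht htK => ?_
      have htu := hZK ht
      simp only [mem_union, mem_insert] at htu
      rcases htu with htT | rfl | htK'
      · exact h t htT htK
      · exact absurd ht hx
      · exact absurd htK' htK
    rw [card_insert_of_notMem hxK] at hle
    omega

/-- Integral duality for minimum weight perfect matchings in a bipartite graph. -/
theorem exists_optimal_matching_and_potential {L R : Type*} [Fintype L] [Fintype R]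
    (hcard : Fintype.card L = Fintype.card R) (E : L → R → Prop) (w : L → R → ℤ)
    (f : L → R) (hf : Function.Injective f) (hE : ∀ x, E x (f x)) :
    ∃ (σ : L → R) (p : L → ℤ) (q : R → ℤ), Function.Bijective σ ∧ (∀ x, E x (σ x)) ∧
      (∀ x y, E x y → p x + q y ≤ w x y) ∧
      ∑ x, w x (σ x) = ∑ x, p x + ∑ y, q y := by
  have bij : ∀ g : L → R, Function.Injective g → Function.Bijective g := fun g hg =>
    (Fintype.bijective_iff_injective_and_card g).2 ⟨hg, hcard⟩
  obtain ⟨m, ⟨p, q, hpq, rfl⟩, hmax⟩ := Int.exists_greatest_of_bdd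
    (P := fun z => ∃ (p : L → ℤ) (q : R → ℤ), (∀ x y, E x y → p x + q y ≤ w x y) ∧
      z = ∑ x, p x + ∑ y, q y)
    ⟨∑ x, w x (f x), by
      rintro z ⟨p, q, hpq, rfl⟩
      rw [← (bij f hf).sum_comp q, ← sum_add_distrib]
      exact sum_le_sum fun x _ => hpq x _ (hE x)⟩
    ⟨_, fun x => -∑ y, |w x y|, fun _ => 0, fun x y _ => by
      have h1 := single_le_sum (f := fun y => |w x y|) (fun y _ => abs_nonneg _) (mem_univ y)
      have h2 := neg_abs_le (w x y)
      linarith, rfl⟩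
  let t : L → Finset R := fun x => univ.filter fun y => E x y ∧ p x + q y = w x y
  have hall : ∀ s : Finset L, s.card ≤ (s.biUnion t).card := by
    intro s
    have hle := hmax _ ⟨fun x => p x + if x ∈ s then 1 else 0,
      fun y => q y - if y ∈ s.biUnion t then 1 else 0, ?_, rfl⟩
    · simp only [sum_add_distrib, sum_sub_distrib, sum_boole, filter_univ_mem] at hle
      zify
      linarith
    · intro x y hxy
      have h1 := hpq x y hxy
      by_cases hx : x ∈ s
      · by_cases hy : y ∈ s.biUnion t
        · simp only [hx, hy, if_true]; linarith
        · have hne : p x + q y ≠ w x y := fun h =>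
            hy (mem_biUnion.2 ⟨x, hx, by simp [t, hxy, h]⟩)
          simp only [hx, hy, if_true, if_false]
          omega
      · simp only [hx, if_false]
        split_ifs <;> linarith
  obtain ⟨σ, hσ, hσt⟩ := (Finset.all_card_le_biUnion_card_iff_exists_injective t).1 hall
  have hσ' : ∀ x, E x (σ x) ∧ p x + q (σ x) = w x (σ x) := fun x => by
    simpa [t] using hσt x
  refine ⟨σ, p, q, bij σ hσ, fun x => (hσ' x).1, hpq, ?_⟩
  rw [← (bij σ hσ).sum_comp q, ← sum_add_distrib]
  exact sum_congr rfl fun x _ => (hσ' x).2.symm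

/-- If every upper level set of `a` is at most as large as that of `b`, then `∑ a ≤ ∑ b`. -/
theorem sum_le_sum_of_card_level_le {L R : Type*} [Fintype L] [Fintype R]
    (hcard : Fintype.card L = Fintype.card R) (a : L → ℤ) (b : R → ℤ)
    (h : ∀ k, (univ.filter fun x => k ≤ a x).card ≤ (univ.filter fun y => k ≤ b y).card) :
    ∑ x, a x ≤ ∑ y, b y := by
  let t : L → Finset R := fun x => univ.filter fun y => a x ≤ b y
  have hall : ∀ s : Finset L, s.card ≤ (s.biUnion t).card := by
    intro s
    rcases s.eq_empty_or_nonempty with rfl | hs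
    · simp
    · obtain ⟨x, hx, hmin⟩ := s.exists_min_image a hs
      calc s.card ≤ (univ.filter fun z => a x ≤ a z).card :=
            card_le_card fun z hz => by simpa using hmin z hz
        _ ≤ (t x).card := h (a x)
        _ ≤ (s.biUnion t).card := card_le_card (subset_biUnion_of_mem t hx)
  obtain ⟨σ, hσ, hσt⟩ := (Finset.all_card_le_biUnion_card_iff_exists_injective t).1 hall
  rw [← ((Fintype.bijective_iff_injective_and_card σ).2 ⟨hσ, hcard⟩).sum_comp b]
  exact sum_le_sum fun x _ => by simpa [t] using hσt x

/-- Every nonempty subpair of `(A, B)` has a vertex of `A` with no `E`-neighbour in the subpair, or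
a vertex of `B` with no `F`-neighbour in the subpair. -/
def Peelable {L R : Type*} (E F : L → R → Prop) (A : Finset L) (B : Finset R) : Prop :=
  ∀ A' ⊆ A, ∀ B' ⊆ B, (A'.Nonempty ∨ B'.Nonempty) →
    (∃ x ∈ A', ∀ y ∈ B', ¬ E x y) ∨ (∃ y ∈ B', ∀ x ∈ A', ¬ F x y)

theorem Peelable.mono {L R : Type*} {E F : L → R → Prop} {A A' : Finset L} {B B' : Finset R}
    (h : Peelable E F A B) (hA : A' ⊆ A) (hB : B' ⊆ B) : Peelable E F A' B' :=
  fun A'' hA'' B'' hB'' => h A'' (hA''.trans hA) B'' (hB''.trans hB)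

theorem exists_injective_of_card_compl_le {L R : Type*} [Fintype R] (G : L → R → Prop)
    (h : ∀ (A : Finset L) (B : Finset R), (∀ x ∈ A, ∀ y ∈ B, ¬ G x y) →
      A.card + B.card ≤ Fintype.card R) :
    ∃ f : L → R, Function.Injective f ∧ ∀ x, G x (f x) := by
  let t : L → Finset R := fun x => univ.filter fun y => G x y
  have hall : ∀ s : Finset L, s.card ≤ (s.biUnion t).card := by
    intro s
    have h1 := h s (s.biUnion t)ᶜ fun x hx y hy hxy =>
      mem_compl.1 hy (mem_biUnion.2 ⟨x, hx, by simpa [t] using hxy⟩)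
    have h2 := card_add_card_compl (s.biUnion t)
    omega
  obtain ⟨f, hf, hft⟩ := (Finset.all_card_le_biUnion_card_iff_exists_injective t).1 hall
  exact ⟨f, hf, fun x => by simpa [t] using hft x⟩

/-- Two bipartite graphs whose peelable pairs are small have perfect matchings `σ` and `τ` such
that `σ` has at most as many descending edges as `τ`. -/
theorem exists_matchings_card_descents_le {L R O : Type*} [Fintype L] [Fintype R] [LinearOrder O]
    (hcard : Fintype.card L = Fintype.card R) (E F : L → R → Prop) (a : L → O) (b : R → O)
    (hpeel : ∀ A B, Peelable E F A B → A.card + B.card ≤ Fintype.card R) :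
    ∃ σ τ : L → R, Function.Bijective σ ∧ Function.Bijective τ ∧
      (∀ x, E x (σ x)) ∧ (∀ x, F x (τ x)) ∧
      (univ.filter fun x => b (σ x) < a x).card ≤ (univ.filter fun x => b (τ x) < a x).card := by
  obtain ⟨f, hf, hfE⟩ := exists_injective_of_card_compl_le E fun A B h =>
    hpeel A B fun A' hA B' hB hne => by
      rcases A'.eq_empty_or_nonempty with rfl | ⟨x, hx⟩
      · obtain ⟨y, hy⟩ := hne.resolve_left (by simp)
        exact Or.inr ⟨y, hy, by simp⟩
      · exact Or.inl ⟨x, hx, fun y hy => h x (hA hx) y (hB hy)⟩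
  obtain ⟨g, hg, hgF⟩ := exists_injective_of_card_compl_le F fun A B h =>
    hpeel A B fun A' hA B' hB hne => by
      rcases B'.eq_empty_or_nonempty with rfl | ⟨y, hy⟩
      · obtain ⟨x, hx⟩ := hne.resolve_right (by simp)
        exact Or.inl ⟨x, hx, by simp⟩
      · exact Or.inr ⟨y, hy, fun x hx => h x (hA hx) y (hB hy)⟩
  obtain ⟨σ, p, q, hσ, hσE, hpq, hsum⟩ := exists_optimal_matching_and_potential hcard E
    (fun x y => if b y < a x then 1 else 0) f hf hfE
  obtain ⟨τ, p', q', hτ, hτF, hpq', hsum'⟩ := exists_optimal_matching_and_potential hcard F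
    (fun x y => -if b y < a x then 1 else 0) g hg hgF
  refine ⟨σ, τ, hσ, hτ, hσE, hτF, ?_⟩
  have key : ∑ x, (p x + p' x) ≤ ∑ y, (-q y - q' y) := by
    refine sum_le_sum_of_card_level_le hcard _ _ fun k => ?_
    have hle := hpeel (univ.filter fun x => k ≤ p x + p' x)
      (univ.filter fun y => ¬ k ≤ -q y - q' y) ?_
    · have := card_filter_add_card_filter_not (s := (univ : Finset R))
        (fun y => k ≤ -q y - q' y)
      rw [card_univ] at this
      omega
    · intro A hA B hB hne
      by_contra! hcon
      obtain ⟨hconA, hconB⟩ := hcon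
      have hAne : A.Nonempty := by
        rcases hne with h | ⟨y, hy⟩
        · exact h
        · obtain ⟨x, hx, -⟩ := hconB y hy
          exact ⟨x, hx⟩
      have hBne : B.Nonempty := by
        obtain ⟨x, hx⟩ := hAne
        obtain ⟨y, hy, -⟩ := hconA x hx
        exact ⟨y, hy⟩
      obtain ⟨x₀, hx₀, hx₀max⟩ := A.exists_max_image
        (fun x => toLex (p x, OrderDual.toDual (a x))) hAne
      obtain ⟨y₀, hy₀, hy₀max⟩ := B.exists_max_image
        (fun y => toLex (q' y, OrderDual.toDual (b y))) hBne
      obtain ⟨y, hy, hx₀y⟩ := hconA x₀ hx₀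
      obtain ⟨x, hx, hxy₀⟩ := hconB y₀ hy₀
      have h1 := hx₀max x hx
      have h2 := hy₀max y hy
      have h3 := hpq _ _ hx₀y
      have h4 := hpq' _ _ hxy₀
      have h5 : k ≤ p x + p' x := by simpa using hA hx
      have h6 : ¬ k ≤ -q y - q' y := by simpa using hB hy
      simp only [Prod.Lex.toLex_le_toLex, OrderDual.toDual_le_toDual] at h1 h2
      have h7 : p x + q y ≤ if b y < a x then 1 else 0 := by
        rcases h1 with h1 | ⟨h1, h1'⟩
        · split_ifs at h3 ⊢ <;> omega
        · by_cases hlt : b y < a x₀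
          · rw [if_pos hlt] at h3
            rw [if_pos (hlt.trans_le h1')]
            omega
          · rw [if_neg hlt] at h3
            split_ifs <;> omega
      have h8 : p' x + q' y ≤ -if b y < a x then 1 else 0 := by
        rcases h2 with h2 | ⟨h2, h2'⟩
        · split_ifs at h4 ⊢ <;> omega
        · by_cases hlt : b y < a x
          · rw [if_pos (h2'.trans_lt hlt)] at h4
            rw [if_pos hlt]
            omega
          · rw [if_neg hlt]
            split_ifs at h4 <;> omega
      omega
  simp only [sum_add_distrib, sum_sub_distrib, sum_neg_distrib, sum_boole] at key hsum hsum'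
  zify
  linarith

/-- The exchange graph of `I` towards `J`, with dummy left vertices standing for the option of
adding an element of `J \ I` without removing one. -/
def exchangeFrom {α : Type*} [DecidableEq α] (M : FinMatroid α) (I J : Finset α) (k : ℕ) :
    {x // x ∈ I \ J} ⊕ Fin k → {y // y ∈ J \ I} → Prop
  | .inl x, y => M.Indep (insert y.1 (I.erase x.1))
  | .inr _, y => M.Indep (insert y.1 I)

/-- The exchange graph of `J` towards `I`, with dummy left vertices joined to everything. -/
def exchangeTo {α : Type*} [DecidableEq α] (M : FinMatroid α) (I J : Finset α) (k : ℕ) :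
    {x // x ∈ I \ J} ⊕ Fin k → {y // y ∈ J \ I} → Prop
  | .inl x, y => M.Indep (insert x.1 (J.erase y.1))
  | .inr _, _ => True

/-- The ground set elements of `I ∩ J`, of `A` (ignoring dummies), and of `B`. -/
def elementsOf {α : Type*} [DecidableEq α] {I J : Finset α} {k : ℕ}
    (A : Finset ({x // x ∈ I \ J} ⊕ Fin k)) (B : Finset {y // y ∈ J \ I}) : Finset α :=
  (I ∩ J) ∪ (A.toLeft.image Subtype.val ∪ B.image Subtype.val)

theorem mem_elementsOf {α : Type*} [DecidableEq α] {I J : Finset α} {k : ℕ}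
    {A : Finset ({x // x ∈ I \ J} ⊕ Fin k)} {B : Finset {y // y ∈ J \ I}} {t : α} :
    t ∈ elementsOf A B ↔
      t ∈ I ∩ J ∨ (∃ x, Sum.inl x ∈ A ∧ x.1 = t) ∨ (∃ y ∈ B, y.1 = t) := by
  simp only [elementsOf, mem_union, mem_image, mem_toLeft]

theorem card_elementsOf {α : Type*} [DecidableEq α] {I J : Finset α} {k : ℕ}
    (A : Finset ({x // x ∈ I \ J} ⊕ Fin k)) (B : Finset {y // y ∈ J \ I}) :
    (elementsOf A B).card = (I ∩ J).card + (A.toLeft.card + B.card) := by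
  rw [elementsOf, card_union_of_disjoint, card_union_of_disjoint,
    card_image_of_injective _ Subtype.val_injective,
    card_image_of_injective _ Subtype.val_injective]
  · rw [disjoint_left]
    intro t ht ht'
    obtain ⟨x, -, rfl⟩ := mem_image.1 ht
    obtain ⟨y, -, hy⟩ := mem_image.1 ht'
    exact (mem_sdiff.1 x.2).2 (hy ▸ (mem_sdiff.1 y.2).1)
  · rw [disjoint_left]
    intro t ht ht'
    rw [mem_inter] at ht
    rcases mem_union.1 ht' with h | h
    · obtain ⟨x, -, rfl⟩ := mem_image.1 h
      exact (mem_sdiff.1 x.2).2 ht.2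
    · obtain ⟨y, -, rfl⟩ := mem_image.1 h
      exact (mem_sdiff.1 y.2).2 ht.1

theorem indep_elementsOf_of_peelable {α : Type*} [DecidableEq α] (M : FinMatroid α)
    {I J : Finset α} (hI : M.Indep I) (hJ : M.Indep J) {k : ℕ} (hk : I.card + k = J.card)
    (A : Finset ({x // x ∈ I \ J} ⊕ Fin k)) (B : Finset {y // y ∈ J \ I})
    (h : Peelable (exchangeFrom M I J k) (exchangeTo M I J k) A B) :
    M.Indep (elementsOf A B) ∧ (I ∩ J).card + (A.card + B.card) ≤ J.card := by
  induction hn : A.card + B.card generalizing A B with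
  | zero =>
    obtain ⟨hA, hB⟩ : A = ∅ ∧ B = ∅ := by
      constructor <;> rw [← card_eq_zero] <;> omega
    subst hA hB
    refine ⟨M.indep_subset (fun t ht => ?_) hI, card_le_card inter_subset_right⟩
    rw [mem_elementsOf] at ht
    simp at ht
    exact ht.1
  | succ n ih =>
    have hne : A.Nonempty ∨ B.Nonempty := by
      simp only [← card_pos]
      omega
    have hcardA := card_toLeft_add_card_toRight (u := A)
    have hright : A.toRight.card ≤ k := by simpa using card_le_univ A.toRight
    have hcard := card_elementsOf A B
    rcases h A Subset.rfl B Subset.rfl hne with ⟨x, hx, hxB⟩ | ⟨y, hy, hyA⟩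
    · have herase := card_erase_add_one hx
      have hT := (ih (A.erase x) B (h.mono (erase_subset _ _) Subset.rfl) (by omega)).1
      have hspan : ∀ y ∈ B, ¬ M.Indep (insert y.1 I) := by
        intro y hy hyI
        rcases x with x | x
        · exact hxB y hy (M.indep_subset (insert_subset_insert _ (erase_subset _ _)) hyI)
        · exact hxB y hy hyI
      have hind : M.Indep (elementsOf A B) := by
        rcases x with x | x
        · have hxI := (mem_sdiff.1 x.2).1
          refine M.indep_subset (fun t ht => ?_) (M.indep_insert_of_spanned (x := x.1)
            (notMem_erase x.1 I) (by rwa [insert_erase hxI]) hT fun t ht htK => ?_)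
          · rw [mem_insert, mem_elementsOf]
            rw [mem_elementsOf] at ht
            rcases ht with ht | ⟨z, hz, rfl⟩ | ht
            · exact Or.inr (Or.inl ht)
            · by_cases hzx : z = x
              · exact Or.inl (congrArg _ hzx)
              · exact Or.inr (Or.inr (Or.inl ⟨z, by simp [hz, hzx], rfl⟩))
            · exact Or.inr (Or.inr (Or.inr ht))
          · rw [mem_elementsOf] at ht
            rcases ht with ht | ⟨z, hz, rfl⟩ | ⟨y, hy, rfl⟩
            · rw [mem_inter] at ht
              exact absurd (mem_erase.2 ⟨fun h => (mem_sdiff.1 x.2).2 (by rw [← h]; exact ht.2), ht.1⟩) htK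
            · refine absurd (mem_erase.2 ⟨fun h => ?_, (mem_sdiff.1 z.2).1⟩) htK
              exact (mem_erase.1 hz).1 (congrArg _ (Subtype.ext h))
            · exact hxB y hy
        · refine M.indep_subset (fun t ht => ?_) hT
          rw [mem_elementsOf] at ht ⊢
          simpa using ht
      refine ⟨hind, ?_⟩
      have hle := M.card_le_of_spanned hind hI fun t ht htI => by
        rw [mem_elementsOf] at ht
        rcases ht with ht | ⟨z, hz, rfl⟩ | ⟨y, hy, rfl⟩
        · exact absurd (mem_inter.1 ht).1 htI
        · exact absurd (mem_sdiff.1 z.2).1 htI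
        · exact hspan y hy
      omega
    · have herase := card_erase_add_one hy
      have hT := (ih A (B.erase y) (h.mono Subset.rfl (erase_subset _ _)) (by omega)).1
      have hyJ := (mem_sdiff.1 y.2).1
      have hind : M.Indep (elementsOf A B) := by
        refine M.indep_subset (fun t ht => ?_) (M.indep_insert_of_spanned (x := y.1)
          (notMem_erase y.1 J) (by rwa [insert_erase hyJ]) hT fun t ht htK => ?_)
        · rw [mem_insert, mem_elementsOf]
          rw [mem_elementsOf] at ht
          rcases ht with ht | ht | ⟨z, hz, rfl⟩
          · exact Or.inr (Or.inl ht)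
          · exact Or.inr (Or.inr (Or.inl ht))
          · by_cases hzy : z = y
            · exact Or.inl (congrArg _ hzy)
            · exact Or.inr (Or.inr (Or.inr ⟨z, by simp [hz, hzy], rfl⟩))
        · rw [mem_elementsOf] at ht
          rcases ht with ht | ⟨x, hx, rfl⟩ | ⟨z, hz, rfl⟩
          · rw [mem_inter] at ht
            exact absurd (mem_erase.2 ⟨fun h => (mem_sdiff.1 y.2).2 (by rw [← h]; exact ht.1), ht.2⟩) htK
          · exact hyA _ hx
          · refine absurd (mem_erase.2 ⟨fun h => ?_, (mem_sdiff.1 z.2).1⟩) htK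
            exact (mem_erase.1 hz).1 (Subtype.ext h)
      have hnodummy : A.toRight.card = 0 := by
        rw [card_eq_zero, eq_empty_iff_forall_notMem]
        exact fun i hi => hyA _ (mem_toRight.1 hi) trivial
      have hle := M.card_le_of_spanned hind hJ fun t ht htJ htI => by
        rw [mem_elementsOf] at ht
        rcases ht with ht | ⟨x, hx, rfl⟩ | ⟨z, hz, rfl⟩
        · exact htJ (mem_inter.1 ht).2
        · exact hyA _ hx (M.indep_subset (insert_subset_insert _ (erase_subset _ _)) htI)
        · exact htJ (mem_sdiff.1 z.2).1
      exact ⟨hind, by omega⟩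

theorem voteB_le_voteN {α : Type*} [DecidableEq α] [Fintype α] (M : FinMatroid α)
    (gt : α → α → Prop) {I J : Finset α} {N : Finset (α × α)} (hN : WeaklyFeasible M I J N) :
    voteB M gt I J ≤ voteN gt I J N := by
  refine csInf_le (Set.Finite.bddBelow ?_) ⟨N, hN, rfl⟩
  refine (Set.finite_range fun N : Finset (α × α) => voteN gt I J N).subset ?_
  rintro z ⟨N', -, rfl⟩
  exact ⟨N', rfl⟩

theorem card_filter_image_univ {γ β : Type*} [Fintype γ] [DecidableEq β] (g : γ → β)
    (hg : Function.Injective g) (P : β → Prop) [DecidablePred P]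
    [DecidablePred fun x => P (g x)] :
    ((univ.image g).filter P).card = (univ.filter fun x => P (g x)).card := by
  rw [filter_image, card_image_of_injective _ hg]
  congr

theorem voteB_add_voteB_le_of_card_le {α : Type*} [DecidableEq α] [Fintype α] [LinearOrder α]
    (M : FinMatroid α) (I J : Finset α) (hI : M.Indep I) (hJ : M.Indep J)
    (hIJ : I.card ≤ J.card) :
    voteB M (fun a b => b < a) I J + voteB M (fun a b => b < a) J I ≤ 0 := by
  obtain ⟨k, hk⟩ := Nat.exists_eq_add_of_le hIJ
  have hcardI := card_sdiff_add_card_inter I J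
  have hcardJ := card_sdiff_add_card_inter J I
  rw [inter_comm J I] at hcardJ
  obtain ⟨σ, τ, hσ, hτ, hσE, hτF, hle⟩ := exists_matchings_card_descents_le
    (O := WithBot α) (by simp only [Fintype.card_sum, Fintype.card_coe, Fintype.card_fin]; omega)
    (exchangeFrom M I J k) (exchangeTo M I J k)
    (Sum.elim (fun x => (x.1 : WithBot α)) fun _ => ⊥) (fun y => (y.1 : WithBot α))
    fun A B h => by
      have := (indep_elementsOf_of_peelable M hI hJ hk.symm A B h).2
      rw [Fintype.card_coe]
      omega
  have hN : WeaklyFeasible M I J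
      (univ.image fun x : {x // x ∈ I \ J} => (x.1, (σ (.inl x)).1)) := by
    refine ⟨⟨?_, ?_, ?_⟩, ?_, ?_⟩
    · simp only [mem_image, mem_univ, true_and]
      rintro _ ⟨x, rfl⟩
      exact ⟨x.2, (σ _).2⟩
    · simp only [mem_image, mem_univ, true_and]
      rintro _ ⟨x, rfl⟩ _ ⟨z, rfl⟩ h
      rw [Subtype.ext h]
    · simp only [mem_image, mem_univ, true_and]
      rintro _ ⟨x, rfl⟩ _ ⟨z, rfl⟩ h
      rw [Sum.inl_injective (hσ.1 (Subtype.ext h))]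
    · simp only [mem_image, mem_univ, true_and]
      rintro _ ⟨x, rfl⟩
      exact hσE (.inl x)
    · intro v hv hdep
      obtain ⟨x | i, hx⟩ := hσ.2 ⟨v, hv⟩
      · exact ⟨_, mem_image_of_mem _ (mem_univ x), by rw [hx]⟩
      · have := hσE (.inr i)
        rw [hx] at this
        exact absurd this hdep
  have hN' : WeaklyFeasible M J I
      (univ.image fun x : {x // x ∈ I \ J} => ((τ (.inl x)).1, x.1)) := by
    refine ⟨⟨?_, ?_, ?_⟩, ?_, ?_⟩
    · simp only [mem_image, mem_univ, true_and]
      rintro _ ⟨x, rfl⟩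
      exact ⟨(τ _).2, x.2⟩
    · simp only [mem_image, mem_univ, true_and]
      rintro _ ⟨x, rfl⟩ _ ⟨z, rfl⟩ h
      rw [Sum.inl_injective (hτ.1 (Subtype.ext h))]
    · simp only [mem_image, mem_univ, true_and]
      rintro _ ⟨x, rfl⟩ _ ⟨z, rfl⟩ h
      rw [Subtype.ext h]
    · simp only [mem_image, mem_univ, true_and]
      rintro _ ⟨x, rfl⟩
      exact hτF (.inl x)
    · exact fun v hv _ => ⟨_, mem_image_of_mem _ (mem_univ ⟨v, hv⟩), rfl⟩
  refine (add_le_add (voteB_le_voteN M _ hN) (voteB_le_voteN M _ hN')).trans ?_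
  have hdesc : ∀ ρ : {x // x ∈ I \ J} ⊕ Fin k → {y // y ∈ J \ I},
      (univ.filter fun x => ((ρ x).1 : WithBot α) <
        Sum.elim (fun x => (x.1 : WithBot α)) (fun _ => ⊥) x).card =
      (univ.filter fun x : {x // x ∈ I \ J} => (ρ (.inl x)).1 < x.1).card := by
    intro ρ
    symm
    rw [← card_map (Function.Embedding.inl (β := Fin k))]
    refine congrArg card (Finset.ext ?_)
    rintro (x | i) <;> simp
  have hasc : ∀ ρ : {x // x ∈ I \ J} ⊕ Fin k → {y // y ∈ J \ I},
      (univ.filter fun x : {x // x ∈ I \ J} => (ρ (.inl x)).1 < x.1).card +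
      (univ.filter fun x : {x // x ∈ I \ J} => x.1 < (ρ (.inl x)).1).card = (I \ J).card := by
    intro ρ
    rw [← Fintype.card_coe (I \ J), ← card_univ,
      ← card_filter_add_card_filter_not (s := univ)
        (fun x : {x // x ∈ I \ J} => (ρ (.inl x)).1 < x.1)]
    refine congrArg _ (congrArg card (Finset.ext fun x => ?_))
    have hne : x.1 ≠ (ρ (.inl x)).1 := fun h =>
      (mem_sdiff.1 x.2).2 (h ▸ (mem_sdiff.1 (ρ (.inl x)).2).1)
    simp [le_iff_lt_or_eq, hne]
  rw [hdesc, hdesc] at hle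
  have h1 := hasc σ
  have h2 := hasc τ
  have hfst : Function.Injective fun x : {x // x ∈ I \ J} => (x.1, (σ (.inl x)).1) :=
    fun x z h => Subtype.ext (congrArg Prod.fst h)
  have hsnd : Function.Injective fun x : {x // x ∈ I \ J} => ((τ (.inl x)).1, x.1) :=
    fun x z h => Subtype.ext (congrArg Prod.snd h)
  simp only [voteN, card_filter_image_univ _ hfst, card_filter_image_univ _ hsnd]
  omega

/-- for any ordered matroid and independent sets `I`, `J`,
`vote•(I,J) + vote•(J,I) ≤ 0`.  (`u ≻ v` is `u > v` in the linear order.) -/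
theorem stmt_2 {α : Type*} [DecidableEq α] [Fintype α] [LinearOrder α]
    (M : FinMatroid α) (I J : Finset α) (hI : M.Indep I) (hJ : M.Indep J) :
    voteB M (fun a b => b < a) I J + voteB M (fun a b => b < a) J I ≤ 0 := by
  rcases le_total I.card J.card with h | h
  · exact voteB_add_voteB_le_of_card_le M I J hI hJ h
  · rw [add_comm]
    exact voteB_add_voteB_le_of_card_le M J I hJ hI h

end
end

section
/- Let M = (S, 𝓘) be a matroid on a finite ground set S given as a direct sum M = M_1 ⊕ … ⊕ M_k of matroids on disjoint sets partitioning S, and let ≻ be a linear order on S. Then for any two independent sets I, J ∈ 𝓘 the following chain of inequalities holds: vote•(I,J) ≤ vote(I,J) ≤ −vote(J,I) ≤ −vote•(J,I). -/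
open Finset
open scoped Classical

noncomputable section

namespace FinMatroid

variable {α : Type*} [DecidableEq α] {M : FinMatroid α}

/-- Augmentation of an independent set by elements of a larger one, up to its cardinality. -/
theorem exists_augmentation {A B : Finset α} (hA : M.Indep A) (hB : M.Indep B)
    (h : A.card ≤ B.card) :
    ∃ D, A ⊆ D ∧ D ⊆ A ∪ B ∧ M.Indep D ∧ D.card = B.card := by
  induction hn : B.card - A.card generalizing A with
  | zero => exact ⟨A, Subset.rfl, subset_union_left, hA, by omega⟩
  | succ n ih =>
    obtain ⟨v, hv, hvA⟩ := M.indep_exchange hA hB (by omega)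
    rw [mem_sdiff] at hv
    have hc := card_insert_of_notMem hv.2
    obtain ⟨D, hAD, hD, hDi, hDc⟩ := ih hvA (by omega) (by omega)
    refine ⟨D, (subset_insert _ _).trans hAD, hD.trans ?_, hDi, hDc⟩
    rw [insert_union]
    exact insert_subset (mem_union_right _ hv.1) Subset.rfl

/-- If `I + v` is dependent, then `v` can be exchanged simultaneously out of `B` and into `I`. -/
theorem exists_symm_exchange {I B : Finset α} (hI : M.Indep I) (hB : M.Indep B) {v : α}
    (hvB : v ∈ B) (hvI : v ∉ I) (hdep : ¬ M.Indep (insert v I)) :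
    ∃ u ∈ I \ B, M.Indep (insert v (I.erase u)) ∧ M.Indep (insert u (B.erase v)) := by
  obtain ⟨C, hCI, hC⟩ := exists_minimal_le_of_wellFoundedLT (fun X => ¬ M.Indep X) _ hdep
  have hCmin : ∀ D, D ⊂ C → M.Indep D := fun D hD => by
    by_contra hDi
    exact hD.2 (hC.2 hDi hD.1)
  have hvC : v ∈ C := by
    by_contra hv
    refine hC.1 (M.indep_subset (fun x hx => ?_) hI)
    have := hCI hx
    grind
  have key : ∃ u ∈ C.erase v, u ∉ B.erase v ∧ M.Indep (insert u (B.erase v)) := by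
    have hCv : M.Indep (C.erase v) := hCmin _ (erase_ssubset hvC)
    have hBv : M.Indep (B.erase v) := M.indep_subset (erase_subset _ _) hB
    have hBc := card_erase_add_one hvB
    rcases lt_or_ge (B.erase v).card (C.erase v).card with hlt | hge
    · obtain ⟨u, hu, hui⟩ := M.indep_exchange hBv hCv hlt
      exact ⟨u, (mem_sdiff.1 hu).1, (mem_sdiff.1 hu).2, hui⟩
    · obtain ⟨D, hCD, hD, hDi, hDc⟩ := exists_augmentation hCv hB (by omega)
      have hvD : v ∉ D := fun hv =>
        hC.1 (M.indep_subset (by rw [← insert_erase hvC]; exact insert_subset hv hCD) hDi)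
      obtain ⟨u, hu, hui⟩ := M.indep_exchange hBv hDi (by omega)
      rw [mem_sdiff] at hu
      refine ⟨u, ?_, hu.2, hui⟩
      have := hD hu.1
      grind
  obtain ⟨u, huC, huB, hui⟩ := key
  rw [mem_erase] at huC
  have huI : u ∈ I := (mem_insert.1 (hCI huC.2)).resolve_left huC.1
  refine ⟨u, by grind, ?_, hui⟩
  have hIc := card_erase_add_one huI
  have hCu : M.Indep (C.erase u) := hCmin _ (erase_ssubset huC.2)
  have hsub : C.erase u ⊆ insert v (I.erase u) := fun x hx => by
    have := hCI (mem_of_mem_erase hx)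
    grind
  have hle := card_le_card hsub
  rw [card_insert_of_notMem (by grind)] at hle
  obtain ⟨D, hCD, hD, hDi, hDc⟩ := exists_augmentation hCu hI (by omega)
  have huD : u ∉ D := fun hu =>
    hC.1 (M.indep_subset (by rw [← insert_erase huC.2]; exact insert_subset hu hCD) hDi)
  have hDsub : D ⊆ insert v (I.erase u) := fun x hx => by
    have := hD hx
    grind
  rw [← eq_of_subset_of_card_le hDsub ?_]
  · exact hDi
  · rw [card_insert_of_notMem (by grind)]
    omega

/-- If `x` extends `B` with two of its elements removed, then it can be exchanged with one of
them. -/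
theorem indep_exchange_or {B : Finset α} (hB : M.Indep B) {v x y : α} (hv : v ∈ B) (hy : y ∈ B)
    (hvy : y ≠ v) (hx : x ∉ B) (h : M.Indep (insert x ((B.erase v).erase y))) :
    M.Indep (insert x (B.erase y)) ∨ M.Indep (insert x (B.erase v)) := by
  have h₁ := card_erase_add_one hv
  have h₂ := card_erase_add_one (mem_erase.2 ⟨hvy, hy⟩)
  have h₃ : (insert x ((B.erase v).erase y)).card = ((B.erase v).erase y).card + 1 :=
    card_insert_of_notMem (by grind)
  obtain ⟨z, hz, hzi⟩ := M.indep_exchange h hB (by omega)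
  have hz' : z = v ∨ z = y := by grind
  rcases hz' with rfl | rfl
  · left
    convert hzi using 1
    grind
  · right
    convert hzi using 1
    grind

/-- Suppose `B` is optimal with respect to exchanges with `I` for the weight `key`. Then `I` and
`B` have a pairing covering `I \ B` by exchanges in `I` along which `key` does not increase. -/
theorem exists_pairing_of_exchange_le {β : Type*} [LinearOrder β] (key : α → β) {I : Finset α}
    (hI : M.Indep I) (B : Finset α) (hB : M.Indep B) (hcard : I.card ≤ B.card)
    (hopt : ∀ x ∈ I \ B, ∀ y ∈ B \ I, M.Indep (insert x (B.erase y)) → key y ≤ key x) :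
    ∃ N, WeaklyFeasible M I B N ∧ (∀ u ∈ I \ B, ∃ p ∈ N, p.1 = u) ∧
      ∀ p ∈ N, key p.2 ≤ key p.1 := by
  induction hn : (B \ I).card generalizing B with
  | zero =>
    have hBI : B ⊆ I := by
      rwa [card_eq_zero, sdiff_eq_empty_iff_subset] at hn
    obtain rfl := eq_of_subset_of_card_le hBI hcard
    exact ⟨∅, by simp [WeaklyFeasible, IsPairing]⟩
  | succ n ih =>
    have hne : (B \ I).Nonempty := card_pos.1 (by omega)
    obtain ⟨v, hv, hmax⟩ := exists_max_image (B \ I) key hne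
    obtain ⟨hvB, hvI⟩ := mem_sdiff.1 hv
    have hBc := card_erase_add_one hvB
    have hBv : M.Indep (B.erase v) := M.indep_subset (erase_subset _ _) hB
    have hopt' : ∀ x ∈ I \ B, ∀ y ∈ B \ I, y ≠ v →
        M.Indep (insert x ((B.erase v).erase y)) → key y ≤ key x := by
      intro x hx y hy hyv h
      rcases indep_exchange_or hB hvB (mem_sdiff.1 hy).1 hyv (mem_sdiff.1 hx).2 h with h | h
      · exact hopt x hx y hy h
      · exact (hmax y hy).trans (hopt x hx v hv h)
    by_cases hdrop : M.Indep (insert v I) ∧ I.card < B.card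
    · obtain ⟨N, ⟨⟨hN₁, hN₂, hN₃⟩, hNi, hNc⟩, hNu, hNk⟩ := ih (B.erase v) hBv (by omega)
        (fun x hx y hy h => hopt' x (by grind) y (by grind) (by grind) h)
        (by rw [erase_sdiff_comm, card_erase_of_mem hv]; omega)
      refine ⟨N, ⟨⟨fun p hp => ?_, hN₂, hN₃⟩, hNi, fun w hw hwi => ?_⟩, fun u hu => ?_, hNk⟩
      · have := hN₁ p hp
        grind
      · have hwv : w ≠ v := by
          rintro rfl
          exact hwi hdrop.1
        exact hNc w (by grind) hwi
      · exact hNu u (by grind)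
    · obtain ⟨u, hu, huI, huB⟩ : ∃ u ∈ I \ B,
          M.Indep (insert v (I.erase u)) ∧ M.Indep (insert u (B.erase v)) := by
        by_cases hdep : M.Indep (insert v I)
        · have : ¬ I.card < B.card := fun h => hdrop ⟨hdep, h⟩
          obtain ⟨u, hu, hui⟩ := M.indep_exchange hBv hI (by omega)
          exact ⟨u, by grind,
            M.indep_subset (insert_subset_insert _ (erase_subset _ _)) hdep, hui⟩
        · exact exists_symm_exchange hI hB hvB hvI hdep
      obtain ⟨huI', huB'⟩ := mem_sdiff.1 hu
      have hc : (insert u (B.erase v)).card = (B.erase v).card + 1 :=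
        card_insert_of_notMem (by grind)
      have hsd : insert u (B.erase v) \ I = (B \ I).erase v := by
        rw [insert_sdiff_of_mem _ huI', erase_sdiff_comm]
      obtain ⟨N, ⟨⟨hN₁, hN₂, hN₃⟩, hNi, hNc⟩, hNu, hNk⟩ := ih (insert u (B.erase v)) huB
        (by omega)
        (fun x hx y hy h => hopt' x (by grind) y (by grind) (by grind)
          (M.indep_subset (by grind) h))
        (by rw [hsd, card_erase_of_mem hv]; omega)
      have hfst : ∀ p ∈ N, p.1 ≠ u := fun p hp => by
        have := (hN₁ p hp).1
        grind
      have hsnd : ∀ p ∈ N, p.2 ≠ v := fun p hp => by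
        have := (hN₁ p hp).2
        grind
      refine ⟨insert (u, v) N, ⟨⟨fun p hp => ?_, ?_, ?_⟩, ?_, fun w hw hwi => ?_⟩,
        fun w hw => ?_, ?_⟩
      · rcases mem_insert.1 hp with rfl | hp
        · exact ⟨hu, hv⟩
        · have := hN₁ p hp
          grind
      · intro p hp q hq h
        rcases mem_insert.1 hp with rfl | hp <;> rcases mem_insert.1 hq with rfl | hq
        · rfl
        · exact absurd h.symm (hfst q hq)
        · exact absurd h (hfst p hp)
        · exact hN₂ p hp q hq h
      · intro p hp q hq h
        rcases mem_insert.1 hp with rfl | hp <;> rcases mem_insert.1 hq with rfl | hq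
        · rfl
        · exact absurd h.symm (hsnd q hq)
        · exact absurd h (hsnd p hp)
        · exact hN₃ p hp q hq h
      · simpa [forall_mem_insert] using ⟨huI, by simpa using hNi⟩
      · by_cases hwv : w = v
        · exact ⟨(u, v), mem_insert_self _ _, hwv.symm⟩
        · obtain ⟨p, hp, rfl⟩ := hNc w (by grind) hwi
          exact ⟨p, mem_insert_of_mem hp, rfl⟩
      · by_cases hwu : w = u
        · exact ⟨(u, v), mem_insert_self _ _, hwu.symm⟩
        · obtain ⟨p, hp, rfl⟩ := hNu w (by grind)
          exact ⟨p, mem_insert_of_mem hp, rfl⟩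
      · simpa [forall_mem_insert] using ⟨hopt u hu v hv huB, by simpa using hNk⟩

end FinMatroid

/-- Egerváry's theorem with integral potentials: if the total potential is bounded below, some
system of potentials is tight on a perfect matching. -/
theorem exists_tight_potential {κ β : Type*} [DecidableEq κ] [DecidableEq β] [Nonempty β]
    (L : Finset κ) (V : Finset β) (hLV : L.card = V.card) (E : κ → β → Prop) (c : κ → β → ℤ)
    (b : ℤ)
    (hb : ∀ (p : κ → ℤ) (q : β → ℤ), (∀ l ∈ L, ∀ v ∈ V, E l v → c l v ≤ p l + q v) →
      b ≤ ∑ l ∈ L, p l + ∑ v ∈ V, q v)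
    (p : κ → ℤ) (q : β → ℤ) (hpq : ∀ l ∈ L, ∀ v ∈ V, E l v → c l v ≤ p l + q v) :
    ∃ (p : κ → ℤ) (q : β → ℤ) (f : κ → β),
      (∀ l ∈ L, ∀ v ∈ V, E l v → c l v ≤ p l + q v) ∧
      Set.InjOn f L ∧ L.image f = V ∧ (∀ l ∈ L, E l (f l)) ∧
      ∑ l ∈ L, p l + ∑ v ∈ V, q v = ∑ l ∈ L, c l (f l) := by
  induction hn : (∑ l ∈ L, p l + ∑ v ∈ V, q v - b).toNat using Nat.strong_induction_on
    generalizing p q with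
  | _ n ih =>
  let t : L → Finset β := fun l => V.filter fun v => E l v ∧ p l + q v = c l v
  by_cases hall : ∀ s : Finset L, s.card ≤ (s.biUnion t).card
  · obtain ⟨g, hg, hgt⟩ := (Finset.all_card_le_biUnion_card_iff_exists_injective t).1 hall
    simp only [t, mem_filter] at hgt
    let f : κ → β := fun l => if h : l ∈ L then g ⟨l, h⟩ else Classical.arbitrary β
    have hf : ∀ l, (h : l ∈ L) → f l = g ⟨l, h⟩ := fun l h => dif_pos h
    have hinj : Set.InjOn f L := fun x hx y hy hxy => by
      rw [hf x hx, hf y hy] at hxy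
      exact congrArg Subtype.val (hg hxy)
    have himg : L.image f = V := by
      refine eq_of_subset_of_card_le (image_subset_iff.2 fun l hl => ?_) ?_
      · rw [hf l hl]
        exact (hgt _).1
      · rw [card_image_of_injOn hinj, hLV]
    refine ⟨p, q, f, hpq, hinj, himg, fun l hl => ?_, ?_⟩
    · rw [hf l hl]
      exact (hgt ⟨l, hl⟩).2.1
    · rw [← himg, sum_image hinj, ← sum_add_distrib]
      refine sum_congr rfl fun l hl => ?_
      rw [hf l hl]
      exact (hgt ⟨l, hl⟩).2.2
  · push Not at hall
    obtain ⟨s, hs⟩ := hall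
    let S : Finset κ := s.map (Function.Embedding.subtype _)
    let T : Finset β := s.biUnion t
    have hSL : S ⊆ L := fun x hx => by
      obtain ⟨y, -, rfl⟩ := mem_map.1 hx
      exact y.2
    have hTV : T ⊆ V := biUnion_subset.2 fun l _ => filter_subset _ _
    have hST : T.card < S.card := by simpa [S] using hs
    let p' : κ → ℤ := fun l => p l - if l ∈ S then 1 else 0
    let q' : β → ℤ := fun v => q v + if v ∈ T then 1 else 0
    have hfeas : ∀ l ∈ L, ∀ v ∈ V, E l v → c l v ≤ p' l + q' v := by
      intro l hl v hv hE
      have h := hpq l hl v hv hE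
      by_cases hlS : l ∈ S
      · by_cases hvT : v ∈ T
        · simp only [p', q', if_pos hlS, if_pos hvT]
          omega
        · have hne : p l + q v ≠ c l v := fun heq => by
            obtain ⟨y, hy, rfl⟩ := mem_map.1 hlS
            exact hvT (mem_biUnion.2 ⟨y, hy, mem_filter.2 ⟨hv, hE, heq⟩⟩)
          simp only [p', q', if_pos hlS, if_neg hvT]
          omega
      · simp only [p', q', if_neg hlS]
        split_ifs <;> omega
    have hp' : ∑ l ∈ L, p' l = ∑ l ∈ L, p l - S.card := by
      simp only [p', sum_sub_distrib]
      rw [sum_ite_mem, inter_eq_right.2 hSL, sum_const, nsmul_one]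
    have hq' : ∑ v ∈ V, q' v = ∑ v ∈ V, q v + T.card := by
      simp only [q', sum_add_distrib]
      rw [sum_ite_mem, inter_eq_right.2 hTV, sum_const, nsmul_one]
    have hb' := hb p' q' hfeas
    exact ih _ (by omega) p' q' hfeas rfl

/-- Sums over two index sets of equal size are bounded below when all cross sums are. -/
theorem sum_add_sum_nonneg_of_card_eq {κ β : Type*} (s : Finset κ) (t : Finset β)
    (hst : s.card = t.card) (a : κ → ℤ) (b : β → ℤ) (h : ∀ i ∈ s, ∀ j ∈ t, 0 ≤ a i + b j) :
    0 ≤ ∑ i ∈ s, a i + ∑ j ∈ t, b j := by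
  let e := s.equivOfCardEq hst
  rw [← sum_coe_sort s a, ← sum_coe_sort t b, ← Equiv.sum_comp e, ← sum_add_distrib]
  exact sum_nonneg fun i _ => h i i.2 _ (e i).2

namespace IsPairing

variable {α : Type*} [DecidableEq α] {I J : Finset α} {N : Finset (α × α)}

theorem injOn_fst (h : IsPairing I J N) : Set.InjOn Prod.fst (N : Set (α × α)) :=
  fun p hp q hq => h.2.1 p hp q hq

theorem injOn_snd (h : IsPairing I J N) : Set.InjOn Prod.snd (N : Set (α × α)) :=
  fun p hp q hq => h.2.2 p hp q hq

theorem image_fst_eq (h : IsPairing I J N) (hu : ∀ u ∈ I \ J, ∃ p ∈ N, p.1 = u) :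
    N.image Prod.fst = I \ J := by
  ext u
  rw [mem_image]
  constructor
  · rintro ⟨p, hp, rfl⟩
    exact (h.1 p hp).1
  · exact hu u

theorem image_snd_subset (h : IsPairing I J N) : N.image Prod.snd ⊆ J \ I :=
  image_subset_iff.2 fun p hp => (h.1 p hp).2

theorem card_eq (h : IsPairing I J N) (hu : ∀ u ∈ I \ J, ∃ p ∈ N, p.1 = u) :
    N.card = (I \ J).card := by
  rw [← h.image_fst_eq hu, card_image_of_injOn h.injOn_fst]

end IsPairing

/-- Signed number of pairs of `N` in which the first entry beats the second one. -/
def margin {α : Type*} (gt : α → α → Prop) (N : Finset (α × α)) : ℤ :=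
  ((N.filter fun p => gt p.1 p.2).card : ℤ) - ((N.filter fun p => gt p.2 p.1).card : ℤ)

theorem margin_eq_sum {α : Type*} (gt : α → α → Prop) (N : Finset (α × α)) :
    margin gt N =
      ∑ p ∈ N, ((if gt p.1 p.2 then (1 : ℤ) else 0) - if gt p.2 p.1 then (1 : ℤ) else 0) := by
  simp only [margin, card_filter, sum_sub_distrib]
  push_cast
  rfl

section Single

variable {α β : Type*} [DecidableEq α] [LinearOrder β] {pos : α → β} {M : FinMatroid α}
  {I J : Finset α}

/-- Admissible edges for exchanges in `J`, where the right summand consists of dummy partners. -/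
def ExchangeEdge (M : FinMatroid α) (I J : Finset α) : α ⊕ ℕ → α → Prop
  | .inl u, v => M.Indep (insert u (J.erase v))
  | .inr _, v => M.Indep (insert v I)

/-- Indicator of the real pairs whose first entry lies above the second one. -/
def edgeWeight (pos : α → β) : α ⊕ ℕ → α → ℤ
  | .inl u, v => if pos v < pos u then 1 else 0
  | .inr _, _ => 0

/-- `I \ J`, padded with dummies to the size of `J \ I`. -/
def paddedSide (I J : Finset α) : Finset (α ⊕ ℕ) :=
  (I \ J).disjSum (range (J.card - I.card))

theorem card_paddedSide (h : I.card ≤ J.card) : (paddedSide I J).card = (J \ I).card := by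
  rw [paddedSide, card_disjSum, card_range]
  have h₁ := card_sdiff_add_card_inter I J
  have h₂ := card_sdiff_add_card_inter J I
  rw [inter_comm] at h₂
  omega

/-- A pairing covering the smaller side is feasible for the trivial partition. -/
theorem feasible_unit_of_cover {N : Finset (α × α)} (hN : WeaklyFeasible M I J N)
    (hcard : I.card ≤ J.card) (hu : ∀ u ∈ I \ J, ∃ p ∈ N, p.1 = u) :
    Feasible M (fun _ => ()) I J N := by
  refine ⟨hN, fun u h _ => hu u h, fun _ _ => rfl, fun j => ?_⟩
  have := card_sdiff_le_card_sdiff_iff.2 hcard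
  simp [hN.1.card_eq hu, this]

/-- Every system of potentials for exchanges in `J` bounds the number of upward pairs in some
feasible pairing for `(I, J)`. -/
theorem exists_feasible_card_le_potential (hpos : Function.Injective pos)
    (hI : M.Indep I) (hJ : M.Indep J) (hcard : I.card ≤ J.card) (p : α ⊕ ℕ → ℤ) (q : α → ℤ)
    (hpq : ∀ l ∈ paddedSide I J, ∀ v ∈ J \ I, ExchangeEdge M I J l v →
      edgeWeight pos l v ≤ p l + q v) :
    ∃ N, Feasible M (fun _ => ()) I J N ∧ N.card = (I \ J).card ∧
      ((N.filter fun x => pos x.2 < pos x.1).card : ℤ) ≤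
        ∑ l ∈ paddedSide I J, p l + ∑ v ∈ J \ I, q v := by
  let wt : α → ℤ := fun x => if x ∈ I then p (.inl x) else - q x
  let key : α → ℤ ×ₗ βᵒᵈ := fun x => toLex (wt x, OrderDual.toDual (pos x))
  have hkey : ∀ x ∈ I \ J, ∀ y ∈ J \ I,
      (key y ≤ key x ↔ edgeWeight pos (.inl x) y ≤ p (.inl x) + q y) := by
    intro x hx y hy
    have hx' := mem_sdiff.1 hx
    have hy' := mem_sdiff.1 hy
    have hne : pos x ≠ pos y := fun h => by
      rw [hpos h] at hx'
      exact hy'.2 hx'.1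
    simp only [key, Prod.Lex.toLex_le_toLex, wt, if_pos hx'.1, if_neg hy'.2,
      OrderDual.toDual_le_toDual, edgeWeight]
    split_ifs with hlt
    · have := hlt.not_ge
      simp only [this, and_false, or_false]
      omega
    · have : pos x ≤ pos y := not_lt.1 hlt
      simp only [this, and_true]
      omega
  obtain ⟨N, hN, hNu, hNk⟩ := FinMatroid.exists_pairing_of_exchange_le key hI J hJ hcard
    fun x hx y hy h => (hkey x hx y hy).2
      (hpq (.inl x) (by rw [paddedSide, inl_mem_disjSum]; exact hx) y hy h)
  have hNc := hN.1.card_eq hNu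
  refine ⟨N, feasible_unit_of_cover hN hcard hNu, hNc, ?_⟩
  have hR : (range (J.card - I.card)).card = ((J \ I) \ N.image Prod.snd).card := by
    rw [card_sdiff_of_subset hN.1.image_snd_subset, card_image_of_injOn hN.1.injOn_snd, hNc]
    have := card_paddedSide hcard
    rw [paddedSide, card_disjSum] at this
    omega
  have hrest := sum_add_sum_nonneg_of_card_eq _ _ hR (fun i => p (.inr i)) q fun i hi v hv => by
    obtain ⟨hv, hvN⟩ := mem_sdiff.1 hv
    refine hpq (.inr i) (by rw [paddedSide, inr_mem_disjSum]; exact hi) v hv ?_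
    by_contra hdep
    obtain ⟨x, hx, rfl⟩ := hN.2.2 v hv hdep
    exact hvN (mem_image_of_mem _ hx)
  have hreal : ((N.filter fun x => pos x.2 < pos x.1).card : ℤ) ≤
      ∑ u ∈ I \ J, p (.inl u) + ∑ v ∈ N.image Prod.snd, q v := by
    rw [← hN.1.image_fst_eq hNu, sum_image hN.1.injOn_fst, sum_image hN.1.injOn_snd,
      ← sum_add_distrib, card_filter]
    push_cast
    exact sum_le_sum fun x hx =>
      (hkey _ (hN.1.1 x hx).1 _ (hN.1.1 x hx).2).1 (hNk x hx)
  rw [paddedSide, sum_disjSum, ← sum_sdiff hN.1.image_snd_subset (f := q)]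
  linarith

/-- The margin is determined by the number of upward pairs. -/
theorem margin_eq_of_isPairing {N : Finset (α × α)} (hpos : Function.Injective pos)
    (hN : IsPairing I J N) : margin (fun a b => pos b < pos a) N =
      2 * ((N.filter fun x => pos x.2 < pos x.1).card : ℤ) - N.card := by
  have h := card_filter_add_card_filter_not (s := N) fun x => pos x.2 < pos x.1
  have heq : (N.filter fun x => ¬ pos x.2 < pos x.1) = N.filter fun x => pos x.1 < pos x.2 := by
    refine filter_congr fun x hx => ?_
    have hne : pos x.1 ≠ pos x.2 := fun h => by
      have := hN.1 x hx
      rw [hpos h] at this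
      exact (mem_sdiff.1 this.1).2 (mem_sdiff.1 this.2).1
    rw [not_lt]
    exact ⟨fun h => lt_of_le_of_ne h hne, le_of_lt⟩
  rw [heq] at h
  have hm : margin (fun a b => pos b < pos a) N =
      ((N.filter fun x => pos x.2 < pos x.1).card : ℤ) -
        (N.filter fun x => pos x.1 < pos x.2).card := by
    rw [margin]
    congr!
  omega

theorem exists_feasible_unit_of_card_le (hpos : Function.Injective pos)
    (hI : M.Indep I) (hJ : M.Indep J) (hcard : I.card ≤ J.card) :
    ∃ N N', Feasible M (fun _ => ()) I J N ∧ Feasible M (fun _ => ()) J I N' ∧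
      margin (fun a b => pos b < pos a) N + margin (fun a b => pos b < pos a) N' ≤ 0 := by
  rcases isEmpty_or_nonempty α with _ | _
  · exact ⟨∅, ∅, by
      simp [Feasible, WeaklyFeasible, IsPairing, margin, eq_empty_of_isEmpty]⟩
  obtain ⟨p, q, f, hpq, hinj, himg, hE, hsum⟩ := exists_tight_potential (paddedSide I J) (J \ I)
    (card_paddedSide hcard) (ExchangeEdge M I J) (edgeWeight pos) 0
    (fun p q hpq => by
      obtain ⟨N, -, -, h⟩ := exists_feasible_card_le_potential hpos hI hJ hcard p q hpq
      exact le_trans (by positivity) h)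
    (fun _ => 1) (fun _ => 0) (by
      rintro (u | i) - v - -
      · simp only [edgeWeight]
        split_ifs <;> norm_num
      · simp [edgeWeight])
  obtain ⟨N, hN, hNc, hle⟩ := exists_feasible_card_le_potential hpos hI hJ hcard p q hpq
  have hinl : ∀ u, Sum.inl u ∈ paddedSide I J ↔ u ∈ I \ J := fun u => inl_mem_disjSum
  have hfmem : ∀ l ∈ paddedSide I J, f l ∈ J \ I := fun l hl => himg ▸ mem_image_of_mem f hl
  have hg : Set.InjOn (fun u => (f (.inl u), u)) ((I \ J : Finset α) : Set α) :=
    fun x _ y _ h => (Prod.mk.inj h).2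
  let N' : Finset (α × α) := (I \ J).image fun u => (f (.inl u), u)
  have hN'c : N'.card = (I \ J).card := card_image_of_injOn hg
  have hpair : IsPairing J I N' := by
    refine ⟨?_, ?_, ?_⟩
    · simp only [N', forall_mem_image]
      exact fun u hu => ⟨hfmem _ ((hinl u).2 hu), hu⟩
    · simp only [N', forall_mem_image]
      intro u hu w hw h
      rw [Sum.inl_injective (hinj ((hinl u).2 hu) ((hinl w).2 hw) h)]
    · simp only [N', forall_mem_image]
      intro u _ w _ h
      rw [show u = w from h]
  have hup : ((N'.filter fun x => pos x.1 < pos x.2).card : ℤ) =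
      ∑ l ∈ paddedSide I J, edgeWeight pos l (f l) := by
    rw [paddedSide, sum_disjSum, card_filter]
    push_cast
    rw [sum_image hg]
    simp [edgeWeight]
  refine ⟨N, N', hN, ⟨⟨hpair, ?_, ?_⟩, ?_, fun _ _ => rfl, fun j => ?_⟩, ?_⟩
  · simp only [N', forall_mem_image]
    exact fun u hu => hE (.inl u) ((hinl u).2 hu)
  · exact fun u hu _ => ⟨_, mem_image_of_mem _ hu, rfl⟩
  · intro v hv hdep
    rw [← himg, mem_image] at hv
    obtain ⟨l, hl, rfl⟩ := hv
    rcases l with u | i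
    · exact ⟨_, mem_image_of_mem _ ((hinl u).1 hl), rfl⟩
    · exact absurd (hE _ hl) hdep
  · have := card_sdiff_le_card_sdiff_iff.2 hcard
    simp [hN'c, this]
  · have h₁ := margin_eq_of_isPairing hpos hN.1.1
    have h₂ := margin_eq_of_isPairing (OrderDual.toDual.injective.comp hpos) hpair
    have h₃ : margin (fun a b => pos b < pos a) N' = - margin (fun a b => pos a < pos b) N' := by
      simp only [margin]
      ring
    simp only [Function.comp_apply, OrderDual.toDual_lt_toDual] at h₂
    omega

/-- Any two independent sets have feasible pairings in both directions, for the trivial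
partition, whose margins add up to at most zero. -/
theorem exists_feasible_unit (hpos : Function.Injective pos) (hI : M.Indep I) (hJ : M.Indep J) :
    ∃ N N', Feasible M (fun _ => ()) I J N ∧ Feasible M (fun _ => ()) J I N' ∧
      margin (fun a b => pos b < pos a) N + margin (fun a b => pos b < pos a) N' ≤ 0 := by
  rcases le_total I.card J.card with h | h
  · exact exists_feasible_unit_of_card_le hpos hI hJ h
  · obtain ⟨N, N', hN, hN', hle⟩ := exists_feasible_unit_of_card_le hpos hJ hI h
    exact ⟨N', N, hN', hN, by linarith⟩

end Single

section DirectSum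

theorem indep_insert_iff_part {α ι : Type*} [DecidableEq α] {M : FinMatroid α} {part : α → ι}
    (hdsum : ∀ X : Finset α, M.Indep X ↔ ∀ j : ι, M.Indep (X.filter fun a => part a = j))
    {X : Finset α} (hX : M.Indep X) (v : α) :
    M.Indep (insert v X) ↔ M.Indep (insert v (X.filter fun a => part a = part v)) := by
  rw [hdsum]
  constructor
  · intro h
    simpa [filter_insert] using h (part v)
  · intro h j
    rw [filter_insert]
    split_ifs with hj
    · rw [← hj]
      exact h
    · exact (hdsum X).1 hX j

theorem margin_eq_sum_parts {α ι : Type*} [Fintype α] (part : α → ι) (gt : α → α → Prop)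
    (N : Finset (α × α)) :
    margin gt N = ∑ j ∈ univ.image part, margin gt (N.filter fun p => part p.1 = j) := by
  simp only [margin_eq_sum]
  exact (sum_fiberwise_of_maps_to (fun p _ => mem_image_of_mem part (mem_univ p.1)) _).symm

theorem bddBelow_votes {α : Type*} [Fintype α] (gt : α → α → Prop) (I J : Finset α)
    (P : Finset (α × α) → Prop) :
    BddBelow {z : ℤ | ∃ N : Finset (α × α), P N ∧ z = voteN gt I J N} := by
  refine ((Set.finite_range (voteN gt I J)).subset ?_).bddBelow
  rintro z ⟨N, -, rfl⟩
  exact ⟨N, rfl⟩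

variable {α ι : Type*} [DecidableEq α] [Fintype α] {M : FinMatroid α} {part : α → ι}
  {I J : Finset α}

/-- Union of the pairings `N j` of the parts. -/
def gluePairing (part : α → ι) (N : ι → Finset (α × α)) : Finset (α × α) :=
  univ.filter fun p => p ∈ N (part p.1)

theorem feasible_gluePairing
    (hdsum : ∀ X : Finset α, M.Indep X ↔ ∀ j : ι, M.Indep (X.filter fun a => part a = j))
    (hI : M.Indep I) (hJ : M.Indep J) {N : ι → Finset (α × α)}
    (hN : ∀ j, Feasible M (fun _ => ()) (I.filter fun a => part a = j)
      (J.filter fun a => part a = j) (N j)) :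
    Feasible M part I J (gluePairing part N) ∧
      ∀ j, (gluePairing part N).filter (fun p => part p.1 = j) = N j := by
  have hmem : ∀ {j p}, p ∈ N j →
      (p.1 ∈ I \ J ∧ part p.1 = j) ∧ (p.2 ∈ J \ I ∧ part p.2 = j) := by
    intro j p hp
    have := (hN j).1.1.1 p hp
    simp only [mem_sdiff, mem_filter] at this ⊢
    tauto
  have hglue : ∀ p, p ∈ gluePairing part N ↔ p ∈ N (part p.1) := fun p => by
    simp [gluePairing]
  have hglue' : ∀ {j p}, p ∈ N j → p ∈ gluePairing part N := fun {j p} hp => by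
    rw [hglue, (hmem hp).1.2]
    exact hp
  have hfiber : ∀ j, (gluePairing part N).filter (fun p => part p.1 = j) = N j := by
    intro j
    ext p
    rw [mem_filter, hglue]
    constructor
    · rintro ⟨h, rfl⟩
      exact h
    · intro h
      have := (hmem h).1.2
      exact ⟨by rwa [this], this⟩
  have hsub : ∀ {A B : Finset α} {j : ι}, (A.filter fun a => part a = j) \
      (B.filter fun a => part a = j) = (A \ B).filter fun a => part a = j := by
    intro A B j
    ext a
    simp only [mem_sdiff, mem_filter]
    tauto
  refine ⟨⟨⟨⟨?_, ?_, ?_⟩, ?_, ?_⟩, ?_, ?_, ?_⟩, hfiber⟩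
  · intro p hp
    have := hmem ((hglue p).1 hp)
    exact ⟨this.1.1, this.2.1⟩
  · intro p hp q hq h
    rw [hglue] at hp hq
    rw [← h] at hq
    exact (hN _).1.1.2.1 p hp q hq h
  · intro p hp q hq h
    rw [hglue] at hp hq
    have : part q.1 = part p.1 := by rw [← (hmem hq).2.2, ← h, (hmem hp).2.2]
    rw [this] at hq
    exact (hN _).1.1.2.2 p hp q hq h
  · intro p hp
    rw [hglue] at hp
    rw [indep_insert_iff_part hdsum (M.indep_subset (erase_subset _ _) hI), (hmem hp).2.2,
      filter_erase]
    exact (hN _).1.2.1 p hp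
  · intro v hv hdep
    rw [indep_insert_iff_part hdsum hI] at hdep
    obtain ⟨p, hp, rfl⟩ := (hN (part v)).1.2.2 v (by rw [hsub]; exact mem_filter.2 ⟨hv, rfl⟩) hdep
    exact ⟨p, hglue' hp, rfl⟩
  · intro u hu hdep
    rw [indep_insert_iff_part hdsum hJ] at hdep
    obtain ⟨p, hp, rfl⟩ := (hN (part u)).2.1 u (by rw [hsub]; exact mem_filter.2 ⟨hu, rfl⟩) hdep
    exact ⟨p, hglue' hp, rfl⟩
  · intro p hp
    exact (hmem ((hglue p).1 hp)).2.2.symm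
  · intro j
    rw [hfiber, ← hsub, ← hsub]
    simpa using (hN j).2.2.2 ()

theorem exists_feasible {β : Type*} [LinearOrder β] {pos : α → β} (hpos : Function.Injective pos)
    (hdsum : ∀ X : Finset α, M.Indep X ↔ ∀ j : ι, M.Indep (X.filter fun a => part a = j))
    (hI : M.Indep I) (hJ : M.Indep J) :
    ∃ N N', Feasible M part I J N ∧ Feasible M part J I N' ∧
      voteN (fun a b => pos b < pos a) I J N + voteN (fun a b => pos b < pos a) J I N' ≤ 0 := by
  choose N N' hN hN' hle using fun j =>
    exists_feasible_unit hpos ((hdsum I).1 hI j) ((hdsum J).1 hJ j)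
  obtain ⟨hG, hGf⟩ := feasible_gluePairing hdsum hI hJ hN
  obtain ⟨hG', hGf'⟩ := feasible_gluePairing hdsum hJ hI hN'
  refine ⟨_, _, hG, hG', ?_⟩
  have hsum : margin (fun a b => pos b < pos a) (gluePairing part N) +
      margin (fun a b => pos b < pos a) (gluePairing part N') ≤ 0 := by
    rw [margin_eq_sum_parts part, margin_eq_sum_parts part, ← sum_add_distrib]
    refine sum_nonpos fun j _ => ?_
    rw [hGf, hGf']
    exact hle j
  simp only [margin] at hsum
  simp only [voteN]
  linarith

variable {gt : α → α → Prop} {N : Finset (α × α)}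

theorem voteF_le (hN : Feasible M part I J N) : voteF M gt part I J ≤ voteN gt I J N :=
  csInf_le (bddBelow_votes _ _ _ _) ⟨N, hN, rfl⟩

theorem voteB_le_voteF (hN : Feasible M part I J N) : voteB M gt I J ≤ voteF M gt part I J :=
  csInf_le_csInf (bddBelow_votes _ _ _ _) ⟨_, N, hN, rfl⟩ fun _ ⟨N, hN, hz⟩ => ⟨N, hN.1, hz⟩

end DirectSum

/-- if `M` is the direct sum along the partition `part`, then for any two
independent sets `I`, `J`:
`vote•(I,J) ≤ vote(I,J) ≤ -vote(J,I) ≤ -vote•(J,I)`.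
(`u ≻ v` is `u > v` in the linear order.) -/
theorem stmt_3 {α ι : Type*} [DecidableEq α] [Fintype α] [LinearOrder α]
    (M : FinMatroid α) (part : α → ι)
    (hdsum : ∀ X : Finset α, M.Indep X ↔ ∀ j : ι, M.Indep (X.filter fun a => part a = j))
    (I J : Finset α) (hI : M.Indep I) (hJ : M.Indep J) :
    voteB M (fun a b => b < a) I J ≤ voteF M (fun a b => b < a) part I J ∧
    voteF M (fun a b => b < a) part I J ≤ -voteF M (fun a b => b < a) part J I ∧
    -voteF M (fun a b => b < a) part J I ≤ -voteB M (fun a b => b < a) J I := by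
  obtain ⟨N, N', hN, hN', hle⟩ :=
    exists_feasible (pos := (id : α → α)) Function.injective_id hdsum hI hJ
  have h₁ := voteF_le (gt := fun a b => b < a) hN
  have h₂ := voteF_le (gt := fun a b => b < a) hN'
  simp only [id] at hle
  exact ⟨voteB_le_voteF hN, by linarith, neg_le_neg (voteB_le_voteF hN')⟩

end
end

section
/- Let M = (S, 𝓘) be a matroid whose finite ground set S is partitioned into two disjoint bases A and B, and let ≻ be a linear order on S. Let E_A = {(u,v) ∈ A × B : A − u + v ∈ 𝓘} and E_B = {(u,v) ∈ A × B : B + u − v ∈ 𝓘}, and for (u,v) ∈ A × B let w(u,v) = 1 if v ≻ u and w(u,v) = 0 if u ≻ v. Suppose π : S → ℤ satisfies π(u) + π(v) ≥ w(u,v) for every (u,v) ∈ E_A. Then the bipartite graph on vertex classes A and B with edge set E = {(u,v) ∈ E_B : π(u) + π(v) ≥ w(u,v)} has a perfect matching, i.e., there is a bijection h : A → B with (u, h(u)) ∈ E for every u ∈ A. -/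
open Finset

noncomputable section

namespace Matroid

variable {α : Type*} {M : Matroid α} {A B : Set α}

/-- If a closure contains every element of a base `B` that can be exchanged for `e`,
then it contains `e`. -/
lemma IsBase.mem_closure_of_forall_exchange {X : Set α} {e : α} (hB : M.IsBase B) (he : e ∈ M.E)
    (heB : e ∉ B)
    (h : ∀ x ∈ B, M.Indep (insert e (B \ {x})) → x ∈ M.closure X) : e ∈ M.closure X := by
  have hcl : e ∈ M.closure B := by rwa [hB.closure_eq]
  have hmem := (hB.fundCircuit_isCircuit he heB).mem_closure_sdiff_singleton_of_mem
    (M.mem_fundCircuit e B)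
  refine M.closure_subset_closure_of_subset_closure ?_ hmem
  rintro x ⟨hxC, hxe⟩
  have hxB : x ∈ B := (M.fundCircuit_subset_insert e B hxC).resolve_left hxe
  refine h x hxB ?_
  rw [hB.indep.mem_fundCircuit_iff hcl heB] at hxC
  rwa [Set.insert_sdiff_singleton_comm (Ne.symm hxe)]

/-- Let `A` and `B` be disjoint bases, where every exchange `A - u + v` that is a base replaces `u`
by an element `v` with a smaller key. If `X ⊆ A` and `N` contains every element of `B` with a
smaller key than some `u ∈ X` for which it can be exchanged, then `(A \ X) ∪ N` is spanning. -/
lemma IsBase.spanning_sdiff_union_of_forall_exchange_lt [Finite α] {β : Type*} [LinearOrder β]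
    {k : α → β} (hk : Function.Injective k) (hA : M.IsBase A) (hB : M.IsBase B)
    (hAB : Disjoint A B)
    (hlt : ∀ u ∈ A, ∀ v ∈ B, M.Indep (insert v (A \ {u})) → k v < k u) {X N : Set α}
    (hNE : N ⊆ M.E)
    (hN : ∀ u ∈ X, ∀ v ∈ B, M.Indep (insert u (B \ {v})) → k v < k u → v ∈ N) :
    M.Spanning (A \ X ∪ N) := by
  have hYE : A \ X ∪ N ⊆ M.E := Set.union_subset (Set.sdiff_subset.trans hA.subset_ground) hNE
  have key : ∀ x, x ∈ A ∪ B → x ∈ M.closure (A \ X ∪ N) := by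
    have hwf : WellFounded fun x y : α ↦ k y < k x :=
      haveI : IsTrans α fun x y ↦ k y < k x := ⟨fun _ _ _ h₁ h₂ ↦ h₂.trans h₁⟩
      haveI : Std.Irrefl fun x y : α ↦ k y < k x := ⟨fun _ ↦ lt_irrefl _⟩
      Finite.wellFounded_of_trans_of_irrefl _
    intro x
    induction x using hwf.induction with
    | _ x ih =>
      rintro (hxA | hxB)
      · by_cases hxX : x ∈ X
        · refine hB.mem_closure_of_forall_exchange (hA.subset_ground hxA)
            (hAB.notMem_of_mem_left hxA) fun v hv hind ↦ ?_
          obtain hvx | hxv := lt_or_gt_of_ne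
            (hk.ne (hAB.ne_of_mem hxA hv).symm)
          · exact M.mem_closure_of_mem (.inr (hN x hxX v hv hind hvx))
          · exact ih v hxv (.inr hv)
        · exact M.mem_closure_of_mem (.inl ⟨hxA, hxX⟩)
      · exact hA.mem_closure_of_forall_exchange (hB.subset_ground hxB)
          (hAB.notMem_of_mem_right hxB) fun u hu hind ↦ ih u (hlt u hu x hxB hind) (.inl hu)
  rw [spanning_iff_ground_subset_closure, ← hA.closure_eq]
  exact M.closure_subset_closure_of_subset_closure fun x hx ↦ key x (.inl hx)

/-- If `A` and `B` are disjoint bases, and every exchange `A - u + v` that is a base decreases the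
key, then there is a bijection `h : A → B` such that `B + u - h u` is independent and
`k (h u) < k u` for all `u ∈ A`. -/
theorem IsBase.exists_bijOn_exchange_lt [Finite α] {β : Type*} [LinearOrder β]
    {k : α → β} (hk : Function.Injective k) (hA : M.IsBase A) (hB : M.IsBase B)
    (hAB : Disjoint A B)
    (hlt : ∀ u ∈ A, ∀ v ∈ B, M.Indep (insert v (A \ {u})) → k v < k u) :
    ∃ h : α → α, Set.BijOn h A B ∧
      ∀ u ∈ A, M.Indep (insert u (B \ {h u})) ∧ k (h u) < k u := by
  classical
  have := Fintype.ofFinite α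
  have hall : ∀ s : Finset A, #s ≤ #{v | ∃ u ∈ s, v ∈ B ∧
      M.Indep (insert (u : α) (B \ {v})) ∧ k v < k u} := by
    intro s
    set N : Finset α := {v | ∃ u ∈ s, v ∈ B ∧ M.Indep (insert (u : α) (B \ {v})) ∧ k v < k u}
      with hNdef
    set X : Finset α := s.map (.subtype _)
    have hXA : (X : Set α) ⊆ A := by
      intro x hx
      obtain ⟨y, -, rfl⟩ := Finset.mem_map.1 (Finset.mem_coe.1 hx)
      exact y.2
    have hspan : M.Spanning (A \ X ∪ N) := by
      refine hA.spanning_sdiff_union_of_forall_exchange_lt hk hB hAB hlt ?_ ?_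
      · intro v hv
        obtain ⟨_, _, hvB, _⟩ := (Finset.mem_filter.1 (Finset.mem_coe.1 hv)).2
        exact hB.subset_ground hvB
      · intro u hu v hv hind hvu
        obtain ⟨y, hy, rfl⟩ := Finset.mem_map.1 (Finset.mem_coe.1 hu)
        simp only [hNdef, Finset.coe_filter, Finset.mem_univ, true_and]
        exact ⟨y, hy, hv, hind, hvu⟩
    obtain ⟨C, hC, hCs⟩ := hspan.exists_isBase_subset
    have hle := (Set.ncard_le_ncard hCs).trans (Set.ncard_union_le _ _)
    have hsum := Set.ncard_sdiff_add_ncard_of_subset hXA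
    rw [hC.ncard_eq_ncard_of_isBase hA, Set.ncard_coe_finset] at hle
    rw [Set.ncard_coe_finset] at hsum
    have : #X = #s := Finset.card_map _
    lia
  obtain ⟨f, hf, hfR⟩ := (Fintype.all_card_le_filter_rel_iff_exists_injective
    fun (u : A) v ↦ v ∈ B ∧ M.Indep (insert (u : α) (B \ {v})) ∧ k v < k u).1 hall
  obtain ⟨h, hhf⟩ : ∃ h : α → α, ∀ u : A, h u = f u :=
    ⟨fun x ↦ if hx : x ∈ A then f ⟨x, hx⟩ else x, fun u ↦ by simp⟩
  have hR : ∀ u ∈ A, h u ∈ B ∧ M.Indep (insert u (B \ {h u})) ∧ k (h u) < k u := by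
    intro u hu
    simpa only [← hhf] using hfR ⟨u, hu⟩
  have hmaps : Set.MapsTo h A B := fun u hu ↦ (hR u hu).1
  have hinj : Set.InjOn h A := fun x hx y hy hxy ↦
    congrArg Subtype.val (hf (a₁ := ⟨x, hx⟩) (a₂ := ⟨y, hy⟩) (by rwa [← hhf, ← hhf]))
  refine ⟨h, ⟨hmaps, hinj, ?_⟩, fun u hu ↦ (hR u hu).2⟩
  rw [Set.SurjOn, Set.eq_of_subset_of_ncard_le hmaps.image_subset]
  rw [hinj.ncard_image, hA.ncard_eq_ncard_of_isBase hB]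

end Matroid

namespace FinMatroid

variable {α : Type*} [DecidableEq α]

/-- The matroid on the whole type with the same independent finsets. -/
def toMatroid_s5 (M : FinMatroid α) : Matroid α :=
  (IndepMatroid.ofFinset Set.univ M.Indep
    (M.exists_indep.elim fun _ hI ↦ M.indep_subset (Finset.empty_subset _) hI)
    (fun _ _ hJ hIJ ↦ M.indep_subset hIJ hJ)
    (fun _ _ hI hJ hlt ↦ by
      obtain ⟨v, hv, hind⟩ := M.indep_exchange hI hJ hlt
      exact ⟨v, (Finset.mem_sdiff.1 hv).1, (Finset.mem_sdiff.1 hv).2, hind⟩)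
    (fun _ _ ↦ Set.subset_univ _)).matroid

lemma toMatroid_indep_coe (M : FinMatroid α) (I : Finset α) :
    M.toMatroid_s5.Indep I ↔ M.Indep I := by
  simp [toMatroid_s5]

lemma IsBase.toMatroid_s5 [Finite α] {M : FinMatroid α} {B : Finset α} (hB : M.IsBase B) :
    M.toMatroid_s5.IsBase B := by
  have := Fintype.ofFinite α
  rw [Matroid.isBase_iff_maximal_indep, maximal_subset_iff]
  refine ⟨(M.toMatroid_indep_coe B).2 hB.1, fun X hX hBX ↦ ?_⟩
  lift X to Finset α using X.toFinite
  rw [hB.2 ((M.toMatroid_indep_coe X).1 hX) (Finset.coe_subset.1 hBX)]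

end FinMatroid

/-- the ground set is partitioned into disjoint bases `A` and `B`; with
`w u v = 1` if `v ≻ u` and `0` if `u ≻ v`, and `π : S → ℤ` satisfying
`π u + π v ≥ w u v` on all of `E_A = {(u,v) : A - u + v independent}`, the bipartite graph with
edge set `E = {(u,v) ∈ E_B : π u + π v ≥ w u v}` (where `E_B = {(u,v) : B + u - v independent}`)
has a perfect matching.  (`u ≻ v` is `u > v` in the given linear order.) -/
theorem stmt_5 {α : Type*} [DecidableEq α] [Fintype α] [LinearOrder α]
    (M : FinMatroid α) (A B : Finset α)
    (hA : M.IsBase A) (hB : M.IsBase B) (hAB : Disjoint A B)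
    (hcover : A ∪ B = Finset.univ)
    (π : α → ℤ)
    (hπ : ∀ u ∈ A, ∀ v ∈ B, M.Indep (insert v (A.erase u)) →
      (if u < v then (1 : ℤ) else 0) ≤ π u + π v) :
    ∃ h : α → α, Set.BijOn h ↑A ↑B ∧
      ∀ u ∈ A, M.Indep (insert u (B.erase (h u))) ∧
        (if u < h u then (1 : ℤ) else 0) ≤ π u + π (h u) := by
  set k : α → ℤ ×ₗ α := fun x ↦ toLex (if x ∈ A then π x else -π x, x) with hkdef
  have hk : Function.Injective k := fun x y hxy ↦ congrArg (fun p ↦ (ofLex p).2) hxy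
  have hk_lt : ∀ u ∈ A, ∀ v ∈ B,
      k v < k u ↔ (if u < v then (1 : ℤ) else 0) ≤ π u + π v := by
    intro u hu v hv
    have hvA : v ∉ A := Finset.disjoint_right.1 hAB hv
    have huv : u ≠ v := fun h ↦ hvA (h ▸ hu)
    simp only [hkdef, Prod.Lex.toLex_lt_toLex, hu, hvA, if_true, if_false]
    obtain h | h := lt_or_gt_of_ne huv
    · simp only [h, h.not_gt, if_true, and_false, or_false]
      lia
    · simp only [h, h.not_gt, if_false, and_true]
      lia
  have hcoe (C : Finset α) (x y : α) :
      M.toMatroid_s5.Indep (insert x ((C : Set α) \ {y})) ↔ M.Indep (insert x (C.erase y)) := by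
    rw [← M.toMatroid_indep_coe, Finset.coe_insert, Finset.coe_erase]
  obtain ⟨h, hbij, hh⟩ := hA.toMatroid_s5.exists_bijOn_exchange_lt hk hB.toMatroid_s5
    (Finset.disjoint_coe.2 hAB)
    fun u hu v hv hind ↦ (hk_lt u hu v hv).2 (hπ u hu v hv ((hcoe A v u).1 hind))
  exact ⟨h, hbij, fun u hu ↦ ⟨(hcoe B u (h u)).1 (hh u hu).1,
    (hk_lt u hu (h u) (hbij.mapsTo hu)).1 (hh u hu).2⟩⟩

end
end

section
/- Let M = (S, 𝓘) be a matroid whose finite ground set S is partitioned into two disjoint bases A and B, let ≻ be a linear order on S, let w(u,v) = 1 if v ≻ u and w(u,v) = 0 if u ≻ v, let E_A = {(u,v) ∈ A × B : A − u + v ∈ 𝓘} and E_B = {(u,v) ∈ A × B : B + u − v ∈ 𝓘}, and let π : S → ℤ satisfy π(u) + π(v) ≥ w(u,v) for every (u,v) ∈ E_A. Define E = {(u,v) ∈ E_B : π(u) + π(v) ≥ w(u,v)}, and define a linear order ≻' on S by: a ≻' b iff π(a) < π(b), or π(a) = π(b) and a ≻ b. Let X ⊆ A and let Y = {v ∈ B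 : (u,v) ∈ E for some u ∈ X} be the neighborhood of X in the bipartite graph (A, B; E). Then for every circuit C of M with C ∩ A ⊆ X, the ≻'-worst (i.e., ≻'-minimal) element of C ∩ B belongs to Y. -/
open Finset

noncomputable section

/-- A circuit of a matroid: an inclusionwise minimal dependent set. -/
def FinMatroid.IsCircuit {α : Type*} [DecidableEq α] (M : FinMatroid α) (C : Finset α) : Prop :=
  ¬ M.Indep C ∧ ∀ ⦃X : Finset α⦄, X ⊂ C → M.Indep X

/-- If a circuit `C` meets an independent set `D` in `d`, then `d` can be exchanged for some
element of `C` outside `D`. -/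
theorem FinMatroid.IsCircuit.exists_insert_erase_indep {α : Type*} [DecidableEq α]
    {M : FinMatroid α} {C D : Finset α} {d : α} (hC : M.IsCircuit C) (hD : M.Indep D)
    (hdC : d ∈ C) (hdD : d ∈ D) : ∃ e ∈ C \ D, M.Indep (insert e (D.erase d)) := by
  classical
  by_contra! hdep
  -- `J` is a largest independent set between `C - d` and `(D - d) ∪ (C - d)`.
  obtain ⟨J, hJ, hJmax⟩ := Finset.exists_max_image
    ((D.erase d ∪ C.erase d).powerset.filter fun J => C.erase d ⊆ J ∧ M.Indep J) Finset.card
    ⟨C.erase d, Finset.mem_filter.2 ⟨Finset.mem_powerset.2 Finset.subset_union_right,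
      Finset.Subset.rfl, hC.2 (Finset.erase_ssubset hdC)⟩⟩
  simp only [Finset.mem_filter, Finset.mem_powerset] at hJ hJmax
  obtain ⟨hJsub, hCJ, hJind⟩ := hJ
  have hJcard : J.card ≤ (D.erase d).card := by
    by_contra! hlt
    obtain ⟨e, he, hind⟩ :=
      M.indep_exchange (M.indep_subset (Finset.erase_subset d D) hD) hJind hlt
    have heJ := hJsub (Finset.mem_sdiff.1 he).1
    exact hdep e (by grind) hind
  obtain ⟨x, hx, hind⟩ :=
    M.indep_exchange hJind hD (hJcard.trans_lt (Finset.card_erase_lt_of_mem hdD))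
  rw [Finset.mem_sdiff] at hx
  by_cases hxd : x = d
  · subst hxd
    refine hC.1 (M.indep_subset ?_ hind)
    rw [← Finset.insert_erase hdC]
    exact Finset.insert_subset_insert x hCJ
  · have hle := hJmax (insert x J) ⟨by grind, hCJ.trans (Finset.subset_insert x J), hind⟩
    rw [Finset.card_insert_of_notMem hx.2] at hle
    omega

/-- setting of Statement 5 (`S` partitioned into disjoint bases `A`, `B`;
`w u v = 1` if `v ≻ u`, else `0`; `π` covering the weights on `E_A`), with
`E = {(u,v) ∈ E_B : π u + π v ≥ w u v}` and the order `a ≻' b ↔ π a < π b ∨ (π a = π b ∧ a ≻ b)`.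
For `X ⊆ A` with neighborhood `Y` of `X` in `(A, B; E)`: every circuit `C` with `C ∩ A ⊆ X`
has its `≻'`-worst element `v` of `C ∩ B` in `Y`, i.e. `v` is joined by an edge of `E` to
some `u ∈ X`.  (`u ≻ v` is `u > v` in the given linear order.) -/
theorem stmt_6 {α : Type*} [DecidableEq α] [Fintype α] [LinearOrder α]
    (M : FinMatroid α) (A B : Finset α)
    (hA : M.IsBase A) (hB : M.IsBase B) (hAB : Disjoint A B)
    (hcover : A ∪ B = Finset.univ)
    (π : α → ℤ)
    (hπ : ∀ u ∈ A, ∀ v ∈ B, M.Indep (insert v (A.erase u)) →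
      (if u < v then (1 : ℤ) else 0) ≤ π u + π v)
    (X : Finset α) (hX : X ⊆ A)
    (C : Finset α) (hC : M.IsCircuit C) (hCA : C ∩ A ⊆ X)
    (v : α) (hv : v ∈ C ∩ B)
    (hworst : ∀ u ∈ C ∩ B, u ≠ v → (π u < π v ∨ (π u = π v ∧ v < u))) :
    ∃ u ∈ X, M.Indep (insert u (B.erase v)) ∧
      (if u < v then (1 : ℤ) else 0) ≤ π u + π v := by
  rename_i instDec _ instOrd
  obtain rfl : instDec = instOrd.toDecidableEq := Subsingleton.elim _ _
  rw [Finset.mem_inter] at hv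
  have hmem (x : α) : x ∈ A ∨ x ∈ B := by
    rw [← Finset.mem_union, hcover]
    exact Finset.mem_univ x
  obtain ⟨u, hu, huB⟩ := hC.exists_insert_erase_indep hB.1 hv.1 hv.2
  rw [Finset.mem_sdiff] at hu
  have huA : u ∈ A := (hmem u).resolve_right hu.2
  obtain ⟨v', hv', hvA⟩ := hC.exists_insert_erase_indep hA.1 hu.1 huA
  rw [Finset.mem_sdiff] at hv'
  have hvB : v' ∈ B := (hmem v').resolve_left hv'.2
  refine ⟨u, hCA (Finset.mem_inter.2 ⟨hu.1, huA⟩), huB, ?_⟩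
  have hcov := hπ u huA v' hvB hvA
  by_cases hne : v' = v
  · rwa [hne] at hcov
  rcases hworst v' (Finset.mem_inter.2 ⟨hv'.1, hvB⟩) hne with hlt | ⟨heq, hlt⟩
  · split_ifs at hcov ⊢ <;> omega
  · split_ifs at hcov ⊢ <;> first | omega | exact absurd (lt_trans ‹u < v› hlt) ‹_›

end
end
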